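/- arXiv:1010.5205 — 7 statements merged into one kernel-verified Lean document; each statement's English description precedes it below -/
import Mathlib

section
/- Let D̄ be a closed disc in ℂ with centre 0 and let F : D̄ → ℂ be of Hölder class C^α(D̄) with 0 < α < 1, satisfying: there exist a nowhere-dense subset E ⊂ D̄ and constants K > 0, ν ≥ 1 such that for each ζ ∈ D̄ \ E there exists C_ζ of modulus 1 with C_ζ·(z − ζ)·(F(z) − F(ζ)) ∈ W(K, ν) for all z ∈ D̄. If, additionally, F ∈ C¹(D̄) (in the real sense) and the set L_F := {z ∈ D̄ : ∂_z̄F(z) = 0} is nowhere dense in D̄ and finitely connected, then [z, F]_{D̄} = C(D̄): every continuous complex-valued function on D̄ is a uniform limit on D̄ of polynomials in z and F(z). -/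
open Complex Metric

def HolderOn (F : ℂ → ℂ) (α : ℝ) (S : Set ℂ) : Prop :=
  ∃ c : ℝ, 0 ≤ c ∧ ∀ z ∈ S, ∀ w ∈ S, ‖F z - F w‖ ≤ c * ‖z - w‖ ^ α

/-- The wedge `W(K, ν) = {u + iv : u ≥ 0, |v| ≤ K u^{1/ν}}`. -/
noncomputable def wedge (K ν : ℝ) : Set ℂ :=
  {w : ℂ | 0 ≤ w.re ∧ |w.im| ≤ K * w.re ^ (1 / ν)}

/-- `S ⊂ ℂ` is finitely connected if its complement in the one-point
compactification of `ℂ` has finitely many connected components. -/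
def FinitelyConnected (S : Set ℂ) : Prop :=
  Finite (ConnectedComponents ↥(((fun z : ℂ => (z : OnePoint ℂ)) '' S)ᶜ))

/-- The Wirtinger derivative `∂F/∂z̄ = (1/2)(∂F/∂x + i ∂F/∂y)` expressed via a
real Fréchet derivative `F'`. -/
noncomputable def dbar (F' : ℂ → ℂ →L[ℝ] ℂ) (z : ℂ) : ℂ :=
  (1 / 2 : ℂ) * (F' z 1 + Complex.I * F' z Complex.I)

open Filter Topology MeasureTheory

/-- The set `{C (z - ζ) (F z - F ζ) | z ∈ S}` lies in the closed right half-plane and meets the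
imaginary axis at most at the origin. -/
def SupportedAt (F : ℂ → ℂ) (S : Set ℂ) (ζ C : ℂ) : Prop :=
  ‖C‖ = 1 ∧ ∀ z ∈ S, 0 ≤ (C * (z - ζ) * (F z - F ζ)).re ∧
    ((C * (z - ζ) * (F z - F ζ)).re = 0 → C * (z - ζ) * (F z - F ζ) = 0)

lemma isClosed_wedge {K ν : ℝ} (hν : 1 ≤ ν) : IsClosed (wedge K ν) := by
  refine (isClosed_le continuous_const continuous_re).inter
    (isClosed_le continuous_im.abs (continuous_const.mul ?_))
  exact continuous_re.rpow_const fun _ => Or.inr (by positivity)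

lemma eq_zero_of_mem_wedge {K ν : ℝ} (hν : 1 ≤ ν) {w : ℂ} (hw : w ∈ wedge K ν) (h : w.re = 0) :
    w = 0 := by
  have h2 := hw.2
  rw [h, Real.zero_rpow (by positivity), mul_zero] at h2
  exact Complex.ext h (abs_nonpos_iff.1 h2)

lemma exists_supportedAt {S E : Set ℂ} {F : ℂ → ℂ} {K ν : ℝ} (hν : 1 ≤ ν)
    (hF : ContinuousOn F S)
    (hyp : ∀ ζ ∈ S \ E, ∃ C : ℂ, ‖C‖ = 1 ∧ ∀ z ∈ S, C * (z - ζ) * (F z - F ζ) ∈ wedge K ν)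
    {ζ : ℂ} (hζS : ζ ∈ S) (hζ : ζ ∈ closure (S \ E)) : ∃ C, SupportedAt F S ζ C := by
  obtain ⟨u, hu, hlim⟩ := mem_closure_iff_seq_limit.1 hζ
  choose c hc using fun n => hyp (u n) (hu n)
  obtain ⟨C, hC, φ, hφ, hcC⟩ := (isCompact_sphere (0 : ℂ) 1).tendsto_subseq
    (x := c) (fun n => by simpa using (hc n).1)
  refine ⟨C, by simpa using hC, fun z hz => ?_⟩
  have hu' : Tendsto (u ∘ φ) atTop (𝓝 ζ) := hlim.comp hφ.tendsto_atTop
  have hFu : Tendsto (fun n => F (u (φ n))) atTop (𝓝 (F ζ)) :=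
    (hF ζ hζS).tendsto.comp
      (tendsto_nhdsWithin_iff.2 ⟨hu', Eventually.of_forall fun n => (hu _).1⟩)
  have hmem : C * (z - ζ) * (F z - F ζ) ∈ wedge K ν := by
    refine (isClosed_wedge hν).mem_of_tendsto
      ((hcC.mul (tendsto_const_nhds.sub hu')).mul (tendsto_const_nhds.sub hFu))
      (Eventually.of_forall fun n => (hc (φ n)).2 z hz)
  exact ⟨hmem.1, eq_zero_of_mem_wedge hν hmem⟩

/-- Removing a nowhere dense set from a closed disc leaves a dense subset of the disc. -/
lemma closedBall_subset_closure_sdiff {r : ℝ} (hr : 0 < r) {E : Set ℂ} (hE : IsNowhereDense E) :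
    closedBall (0 : ℂ) r ⊆ closure (closedBall 0 r \ E) := by
  have hd : Dense (Eᶜ) := by
    rw [← interior_eq_empty_iff_dense_compl]
    exact Set.subset_empty_iff.1 ((interior_mono subset_closure).trans hE.subset)
  rw [← closure_ball (0 : ℂ) hr.ne']
  calc closure (ball (0 : ℂ) r) ⊆ closure (ball 0 r ∩ Eᶜ) :=
        closure_minimal (hd.open_subset_closure_inter isOpen_ball) isClosed_closure
    _ ⊆ closure (closure (ball 0 r) \ E) :=
        closure_mono fun z hz => ⟨subset_closure hz.1, hz.2⟩

/-- A set all of whose points see uniformly large holes of `T` at all small scales is null. -/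
lemma volume_eq_zero_of_holes {X T : Set ℂ} (hT : MeasurableSet X) (hXT : X ⊆ T)
    (h : ∀ x ∈ X, ∀ s > 0, ∃ p, ball p (s / 4) ⊆ closedBall x s ∧ Disjoint (ball p (s / 4)) T) :
    volume X = 0 := by
  have key : ∀ᵐ x ∂(volume.restrict T), x ∉ X := by
    filter_upwards [Besicovitch.ae_tendsto_measure_inter_div volume T] with x hx hxX
    have hle : ∀ᶠ s in 𝓝[>] (0 : ℝ),
        volume (T ∩ closedBall x s) / volume (closedBall x s) ≤ 15 / 16 := by
      filter_upwards [self_mem_nhdsWithin] with s hs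
      have hs : 0 < s := hs
      obtain ⟨p, hp, hpT⟩ := h x hxX s hs
      have hadd : volume (T ∩ closedBall x s) + volume (ball p (s / 4)) ≤
          volume (closedBall x s) := by
        rw [← measure_union (hpT.symm.mono_left Set.inter_subset_left) measurableSet_ball]
        exact measure_mono (Set.union_subset Set.inter_subset_right hp)
      have e1 : volume (closedBall x s) = ENNReal.ofReal (s ^ 2 * Real.pi) := by
        rw [Complex.volume_closedBall, ENNReal.ofReal_mul (by positivity),
          ENNReal.ofReal_pow hs.le, ← NNReal.coe_real_pi, ENNReal.ofReal_coe_nnreal]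
      have e2 : volume (ball p (s / 4)) = ENNReal.ofReal ((s / 4) ^ 2 * Real.pi) := by
        rw [Complex.volume_ball, ENNReal.ofReal_mul (by positivity),
          ENNReal.ofReal_pow (by positivity), ← NNReal.coe_real_pi, ENNReal.ofReal_coe_nnreal]
      have hfin : volume (T ∩ closedBall x s) ≠ ⊤ :=
        measure_ne_top_of_subset Set.inter_subset_right (by rw [e1]; exact ENNReal.ofReal_ne_top)
      have hpi := Real.pi_pos
      refine ENNReal.div_le_of_le_mul ?_
      rw [e2] at hadd
      rw [e1] at hadd ⊢
      rw [← ENNReal.ofReal_toReal hfin] at hadd ⊢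
      have h16 : (15 / 16 : ENNReal) = ENNReal.ofReal (15 / 16) := by
        rw [ENNReal.ofReal_div_of_pos (by norm_num)]; norm_num
      rw [h16, ← ENNReal.ofReal_mul (by norm_num)]
      rw [← ENNReal.ofReal_add ENNReal.toReal_nonneg (by positivity),
        ENNReal.ofReal_le_ofReal_iff (by positivity)] at hadd
      apply ENNReal.ofReal_le_ofReal
      nlinarith
    have h1 : (1 : ENNReal) ≤ 15 / 16 := le_of_tendsto hx hle
    have h2 : (15 / 16 : ENNReal) < 1 := by
      rw [ENNReal.div_lt_iff (by norm_num) (by norm_num)]; norm_num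
    exact absurd h1 (not_le.2 h2)
  have := ae_iff.1 key
  simp only [not_not, Set.ofPred_mem_eq] at this
  rwa [Measure.restrict_apply hT, Set.inter_eq_left.2 hXT] at this

lemma re_mul_nonpos {a b : ℂ} (ha : |a.im| ≤ a.re) (hb : b.re ≤ -|b.im|) : (a * b).re ≤ 0 := by
  rw [Complex.mul_re]
  have h1 : -(a.im * b.im) ≤ |a.im| * |b.im| := by rw [← abs_mul]; exact neg_le_abs _
  nlinarith [abs_nonneg a.im, abs_nonneg b.im,
    mul_le_mul_of_nonneg_right ha (abs_nonneg b.im),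
    mul_le_mul_of_nonneg_left hb ((abs_nonneg _).trans ha)]

lemma exists_rotation_quadrant (w : ℂ) :
    ∃ k ∈ Finset.range 4, |(I ^ k * w).im| ≤ (I ^ k * w).re := by
  rcases le_total |w.im| |w.re| with h | h
  · rcases le_total 0 w.re with h0 | h0
    · exact ⟨0, by simp, by simpa [abs_of_nonneg h0] using h⟩
    · exact ⟨2, by simp, by simpa [abs_of_nonpos h0] using h⟩
  · have e3 : I ^ 3 = -I := by rw [pow_succ, I_sq]; ring
    rcases le_total 0 w.im with h0 | h0
    · exact ⟨3, by simp, by simpa [e3, abs_of_nonneg h0] using h⟩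
    · exact ⟨1, by simp, by simpa [abs_of_nonpos h0] using h⟩

/-- Level sets with empty relative interior are null. -/
lemma volume_level_eq_zero {S : Set ℂ} {F : ℂ → ℂ} (hS : IsClosed S) (hF : ContinuousOn F S)
    (hsup : ∀ ζ ∈ S, ∃ C, SupportedAt F S ζ C) (c : ℂ)
    (hd : {z ∈ S | F z = c} ⊆ closure {z ∈ S | F z ≠ c}) :
    volume {z ∈ S | F z = c} = 0 := by
  have hX : IsClosed {z ∈ S | F z = c} :=
    hF.preimage_isClosed_of_isClosed hS isClosed_singleton
  set U : ℕ → Set ℂ := fun k =>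
    {z | (z ∈ S ∧ F z ≠ c) ∧ |(I ^ k * (F z - c)).im| ≤ (I ^ k * (F z - c)).re} with hU
  have hcover : {z ∈ S | F z = c} ⊆
      ⋃ k ∈ Finset.range 4, {z ∈ S | F z = c} ∩ closure (U k) := by
    intro z hz
    have h1 : {z ∈ S | F z ≠ c} ⊆ ⋃ k ∈ Finset.range 4, U k := fun z hz => by
      obtain ⟨k, hk, h⟩ := exists_rotation_quadrant (F z - c)
      exact Set.mem_biUnion (x := k) hk ⟨hz, h⟩
    have h2 := closure_mono h1 (hd hz)
    rw [Finset.closure_biUnion] at h2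
    simp only [Set.mem_iUnion] at h2 ⊢
    obtain ⟨k, hk, h⟩ := h2
    exact ⟨k, hk, hz, h⟩
  refine measure_mono_null hcover ((measure_biUnion_null_iff (Finset.countable_toSet _)).2 ?_)
  intro k _
  refine volume_eq_zero_of_holes (hX.inter isClosed_closure).measurableSet
    Set.inter_subset_right ?_
  rintro ζ ⟨⟨hζS, hζ⟩, -⟩ s hs
  obtain ⟨C, hC, hCz⟩ := hsup ζ hζS
  set e : ℂ := C * (I ^ k)⁻¹ with he
  have hen : ‖e‖ = 1 := by simp [he, hC]
  have he0 : e ≠ 0 := norm_ne_zero_iff.1 (by rw [hen]; norm_num)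
  have hcen : ‖(s / 2 : ℂ) * e⁻¹‖ = s / 2 := by
    rw [norm_mul, norm_inv, hen]; simp [abs_of_pos hs]
  refine ⟨ζ - (s / 2 : ℂ) * e⁻¹, fun z hz => ?_, ?_⟩
  · rw [mem_ball, dist_eq_norm] at hz
    rw [mem_closedBall, dist_eq_norm]
    calc ‖z - ζ‖ = ‖(z - (ζ - (s / 2 : ℂ) * e⁻¹)) - (s / 2 : ℂ) * e⁻¹‖ := by congr 1; ring
      _ ≤ _ := (norm_sub_le _ _)
      _ ≤ s := by rw [hcen]; linarith
  · refine Disjoint.closure_right (Set.disjoint_left.2 ?_) isOpen_ball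
    rintro z hz ⟨⟨hzS, hzc⟩, ha⟩
    rw [mem_ball, dist_eq_norm] at hz
    set v := e * (z - (ζ - (s / 2 : ℂ) * e⁻¹)) with hv
    have hvn : ‖v‖ < s / 4 := by rw [hv, norm_mul, hen, one_mul]; exact hz
    have hb : e * (z - ζ) = v - ((s / 2 : ℝ) : ℂ) := by
      rw [hv]; push_cast; field_simp; ring
    have hbq : (e * (z - ζ)).re ≤ -|(e * (z - ζ)).im| := by
      rw [hb, Complex.sub_re, Complex.sub_im, Complex.ofReal_re, Complex.ofReal_im, sub_zero]
      have := (Complex.abs_re_le_norm v).trans_lt hvn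
      have := (Complex.abs_im_le_norm v).trans_lt hvn
      linarith [le_abs_self v.re]
    have hprod : C * (z - ζ) * (F z - F ζ) = I ^ k * (F z - c) * (e * (z - ζ)) := by
      rw [he, hζ]; field_simp
    have hle := re_mul_nonpos ha hbq
    rw [← hprod] at hle
    obtain ⟨h0, h0'⟩ := hCz z hzS
    have hzero := h0' (le_antisymm hle h0)
    have hzζ : z ≠ ζ := fun h => hzc (h ▸ hζ)
    have hC0 : C ≠ 0 := norm_ne_zero_iff.1 (by rw [hC]; norm_num)
    rw [hζ] at hzero
    exact mul_ne_zero (mul_ne_zero hC0 (sub_ne_zero.2 hzζ)) (sub_ne_zero.2 hzc) hzero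

/-- If `∂F/∂z̄` vanishes only on a nowhere dense set, the level sets have no interior. -/
lemma level_subset_closure {r : ℝ} (hr : 0 < r) {F : ℂ → ℂ} {F' : ℂ → ℂ →L[ℝ] ℂ}
    (hF' : ∀ z ∈ closedBall (0 : ℂ) r, HasFDerivWithinAt F (F' z) (closedBall 0 r) z)
    (hL : IsNowhereDense {z ∈ closedBall (0 : ℂ) r | dbar F' z = 0}) (c : ℂ) :
    {z ∈ closedBall (0 : ℂ) r | F z = c} ⊆ closure {z ∈ closedBall (0 : ℂ) r | F z ≠ c} := by
  have hX : IsClosed {z ∈ closedBall (0 : ℂ) r | F z = c} :=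
    ContinuousOn.preimage_isClosed_of_isClosed (fun z hz => (hF' z hz).continuousWithinAt)
      isClosed_closedBall isClosed_singleton
  have hnd : IsNowhereDense {z ∈ closedBall (0 : ℂ) r | F z = c} := by
    rw [hX.isNowhereDense_iff, ← Set.subset_empty_iff, ← hL]
    refine interior_maximal (fun z hz => subset_closure ?_) isOpen_interior
    have hz' := interior_subset hz
    have hD : closedBall (0 : ℂ) r ∈ 𝓝 z :=
      mem_of_superset (isOpen_interior.mem_nhds hz) fun w hw => (interior_subset hw).1
    have h1 : HasFDerivAt F (F' z) z := (hF' z hz'.1).hasFDerivAt hD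
    have h2 : F =ᶠ[𝓝 z] fun _ => c :=
      mem_of_superset (isOpen_interior.mem_nhds hz) fun w hw => (interior_subset hw).2
    have h3 : F' z = 0 := h1.unique ((hasFDerivAt_const c z).congr_of_eventuallyEq h2)
    exact ⟨hz'.1, by simp [dbar, h3]⟩
  intro ζ hζ
  have hsub : closedBall (0 : ℂ) r \ {z ∈ closedBall (0 : ℂ) r | F z = c} ⊆
      {z ∈ closedBall (0 : ℂ) r | F z ≠ c} := fun z hz => ⟨hz.1, fun h => hz.2 ⟨hz.1, h⟩⟩
  exact closure_mono hsub (closedBall_subset_closure_sdiff hr hnd hζ.1)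

lemma locallyIntegrable_norm_inv : LocallyIntegrable (fun w : ℂ => ‖w‖⁻¹) := by
  refine locallyIntegrable_of_norm_le_rpow (C := 1) (α := 1) (by simp) (by simp)
    (Eventually.of_forall fun w => by simp [Real.rpow_neg_one]) ?_
  exact measurable_norm.inv.aestronglyMeasurable

lemma locallyIntegrable_inv : LocallyIntegrable (fun w : ℂ => w⁻¹) :=
  locallyIntegrable_norm_inv.mono measurable_inv.aestronglyMeasurable
    (Eventually.of_forall fun w => by simp)

lemma integrableOn_cauchyKernel (z : ℂ) (r : ℝ) :
    IntegrableOn (fun ζ : ℂ => (z - ζ)⁻¹) (closedBall 0 r) := by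
  have h := (locallyIntegrable_inv.integrableOn_isCompact (isCompact_closedBall z r))
  have h2 := ((Measure.measurePreserving_sub_left volume z).integrableOn_comp_preimage
    (Homeomorph.subLeft z).measurableEmbedding).2 h
  convert h2 using 1
  · rfl
  · ext w
    simp only [mem_closedBall, dist_eq_norm, Set.mem_preimage, sub_zero]
    rw [sub_sub_cancel_left, norm_neg]

/-- The circle averages of the Cauchy kernel. -/
lemma circleAverage_cauchyKernel {z : ℂ} {ρ : ℝ} (hρ : 0 < ρ) (hne : ρ ≠ ‖z‖) :
    Real.circleAverage (fun ζ => (z - ζ)⁻¹) 0 ρ = if ρ < ‖z‖ then z⁻¹ else 0 := by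
  split_ifs with h
  · have hd : DiffContOnCl ℂ (fun ζ : ℂ => (z - ζ)⁻¹) (ball 0 |ρ|) := by
      have h0 : ∀ ζ ∈ closedBall (0 : ℂ) |ρ|, z - ζ ≠ 0 := fun ζ hζ h0 => by
        rw [abs_of_pos hρ, mem_closedBall_zero_iff, ← sub_eq_zero.1 h0] at hζ
        linarith
      refine DifferentiableOn.diffContOnCl ?_
      rw [closure_ball _ (by simpa using hρ.ne')]
      exact (differentiableOn_const _ |>.sub differentiableOn_id).inv h0
    simpa using hd.circleAverage
  · have hz : ‖z‖ < ρ := lt_of_le_of_ne (not_lt.1 h) (Ne.symm hne)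
    by_cases hz0 : z = 0
    · subst hz0
      rw [Real.circleAverage_eq_circleIntegral hρ.ne']
      have := circleIntegral.integral_sub_zpow_of_ne (n := -2) (by norm_num) 0 0 ρ
      have h2 : (∮ w in C(0, ρ), (w - 0)⁻¹ • (0 - w)⁻¹) =
          (-1) * (∮ w in C(0, ρ), (w - 0) ^ (-2 : ℤ)) := by
        rw [← circleIntegral.integral_const_mul]
        refine circleIntegral.integral_congr hρ.le fun w _ => ?_
        simp only [sub_zero, zero_sub, smul_eq_mul, inv_neg, mul_neg, zpow_neg, neg_mul, one_mul, neg_inj]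
        rw [← mul_inv]; congr 1; exact (sq w).symm
      rw [h2, this]; simp
    · have hmem : z ∈ ball (0 : ℂ) |ρ| := by rw [abs_of_pos hρ]; simpa using hz
      have h1 :=
        (diffContOnCl_const (c := (1 : ℂ)) (s := ball (0 : ℂ) |ρ|)
        (𝕜 := ℂ)).circleAverage_smul_div hmem
      have hci : CircleIntegrable (fun w : ℂ => w / (w - z)) 0 ρ := by
        refine ContinuousOn.circleIntegrable hρ.le
          (continuousOn_id.div (by fun_prop) fun w hw h0 => ?_)
        rw [mem_sphere_zero_iff_norm, sub_eq_zero.1 h0] at hw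
        linarith
      have h2 : Set.EqOn (fun ζ : ℂ => (z - ζ)⁻¹)
          (fun ζ : ℂ => z⁻¹ • (1 - ζ / (ζ - z))) (sphere 0 |ρ|) := fun w hw => by
        rw [abs_of_pos hρ, mem_sphere_zero_iff_norm] at hw
        have : w - z ≠ 0 := fun h0 => by rw [sub_eq_zero.1 h0] at hw; linarith
        have : z - w ≠ 0 := fun h0 => this (by rw [← neg_sub, h0, neg_zero])
        simp only [smul_eq_mul]
        field_simp
        ring
      rw [Real.circleAverage_congr_sphere h2]
      have h3 := Real.circleAverage_fun_sub (circleIntegrable_const (1 : ℂ) 0 ρ) hci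
      have h4 : Real.circleAverage (fun w : ℂ => w / (w - z)) 0 ρ = 1 := by simpa using h1
      rw [Real.circleAverage_fun_smul, h3, h4]
      simp [Real.circleAverage_const]

/-- The Cauchy transform of area measure on a disc is `π z̄`. -/
lemma integral_cauchyKernel {z : ℂ} {r : ℝ} (hz : ‖z‖ ≤ r) :
    ∫ ζ in closedBall (0 : ℂ) r, (z - ζ)⁻¹ = Real.pi * (starRingEnd ℂ) z := by
  set f : ℂ → ℂ := (closedBall (0 : ℂ) r).indicator fun ζ => (z - ζ)⁻¹ with hf
  have hfm : Measurable f :=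
    (measurable_const.sub measurable_id).inv.indicator measurableSet_closedBall
  have hfi : Integrable f :=
    (integrable_indicator_iff measurableSet_closedBall).2 (integrableOn_cauchyKernel z r)
  have hsymm : Measurable fun p : ℝ × ℝ => Complex.polarCoord.symm p := by
    simp only [Complex.polarCoord_symm_apply]
    fun_prop
  have hGi : IntegrableOn (fun p : ℝ × ℝ => p.1 • f (Complex.polarCoord.symm p))
      polarCoord.target := by
    refine ⟨(measurable_fst.smul (hfm.comp hsymm)).aestronglyMeasurable, ?_⟩
    have h1 := Complex.lintegral_comp_polarCoord_symm fun ζ => ‖f ζ‖ₑ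
    refine lt_of_le_of_lt (le_of_eq ?_) hfi.hasFiniteIntegral
    refine Eq.trans ?_ h1
    refine setLIntegral_congr_fun polarCoord.open_target.measurableSet fun p hp => ?_
    have hp0 : 0 < p.1 := hp.1
    simp only [enorm_smul, smul_eq_mul, Real.enorm_eq_ofReal hp0.le]
  rw [← integral_indicator measurableSet_closedBall, ← hf, ← Complex.integral_comp_polarCoord_symm]
  change IntegrableOn _ (Set.Ioi (0 : ℝ) ×ˢ Set.Ioo (-Real.pi) Real.pi) (volume.prod volume) at hGi
  change ∫ p in Set.Ioi (0 : ℝ) ×ˢ Set.Ioo (-Real.pi) Real.pi, _ ∂(volume.prod volume) = _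
  rw [setIntegral_prod _ hGi]
  have hinner : ∀ᵐ ρ : ℝ, ρ ∈ Set.Ioi (0 : ℝ) →
      (∫ θ in Set.Ioo (-Real.pi) Real.pi, ρ • f (Complex.polarCoord.symm (ρ, θ))) =
        (Set.Ioo 0 ‖z‖).indicator (fun ρ : ℝ => ((ρ : ℂ) * (2 * Real.pi * z⁻¹))) ρ := by
    filter_upwards [compl_mem_ae_iff.2 (measure_singleton ‖z‖)] with ρ hne hρ
    have hρ : 0 < ρ := hρ
    have hne : ρ ≠ ‖z‖ := hne
    have hpol : ∀ θ, Complex.polarCoord.symm (ρ, θ) = circleMap 0 ρ θ := fun θ => by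
      rw [Complex.polarCoord_symm_apply, circleMap, zero_add, Complex.exp_mul_I]
      push_cast; rfl
    have hnorm : ∀ θ, ‖circleMap 0 ρ θ‖ = ρ := fun θ => by simp [abs_of_pos hρ]
    simp only [hpol]
    by_cases hρr : ρ ≤ r
    · have hfc : ∀ θ, f (circleMap 0 ρ θ) = (z - circleMap 0 ρ θ)⁻¹ := fun θ =>
        Set.indicator_of_mem (by simp only [mem_closedBall_zero_iff, hnorm, hρr]) _
      simp only [hfc]
      have hav := circleAverage_cauchyKernel hρ hne
      rw [Real.circleAverage_eq_integral_add (-Real.pi),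
        intervalIntegral.integral_comp_add_right (fun θ => (z - circleMap 0 ρ θ)⁻¹),
        zero_add, show 2 * Real.pi + -Real.pi = Real.pi by ring,
        intervalIntegral.integral_of_le (by linarith [Real.pi_pos]),
        integral_Ioc_eq_integral_Ioo, inv_smul_eq_iff₀ (by positivity)] at hav
      rw [integral_smul, hav, Set.indicator_apply]
      simp only [Set.mem_Ioo, hρ, true_and]
      split_ifs
      · simp only [Complex.real_smul]; push_cast; ring
      · simp
    · have hfc : ∀ θ, f (circleMap 0 ρ θ) = 0 := fun θ =>
        Set.indicator_of_notMem
          (by simp only [mem_closedBall_zero_iff, hnorm, hρr, not_false_eq_true]) _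
      have : ρ ∉ Set.Ioo 0 ‖z‖ := fun h => hρr (h.2.le.trans hz)
      simp [hfc, this]
  rw [setIntegral_congr_ae measurableSet_Ioi hinner, setIntegral_indicator measurableSet_Ioo,
    Set.inter_eq_right.2 fun x hx => hx.1, integral_mul_const]
  rw [← integral_Ioc_eq_integral_Ioo, ← intervalIntegral.integral_of_le (norm_nonneg z),
    intervalIntegral.integral_ofReal, integral_id]
  by_cases hz0 : z = 0
  · simp [hz0]
  · push_cast
    have := Complex.mul_conj' z
    field_simp
    rw [← this]; ring

/-- In a closed algebra of continuous functions, a function with nonnegative real part has its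
resolvent at negative reals in the algebra. -/
lemma exists_mem_mul_add_eq_one {X : Type*} [TopologicalSpace X] [CompactSpace X]
    {A : Subalgebra ℂ C(X, ℂ)} (hA : IsClosed (A : Set C(X, ℂ))) {h : C(X, ℂ)} (hh : h ∈ A)
    (hre : ∀ x, 0 ≤ (h x).re) {δ : ℝ} (hδ : 0 < δ) :
    ∃ k ∈ A, ∀ x, k x * (h x + δ) = 1 := by
  obtain ⟨M, hM0, hM⟩ : ∃ M : ℝ, δ < M ∧ δ ^ 2 + ‖h‖ ^ 2 < 2 * M * δ := by
    refine ⟨δ + (δ ^ 2 + ‖h‖ ^ 2) / δ,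
      by linarith [show 0 < (δ ^ 2 + ‖h‖ ^ 2) / δ by positivity], ?_⟩
    have : (δ ^ 2 + ‖h‖ ^ 2) / δ * δ = δ ^ 2 + ‖h‖ ^ 2 := by field_simp
    nlinarith [sq_nonneg ‖h‖]
  have hMpos : 0 < M := hδ.trans hM0
  set t : C(X, ℂ) := 1 - (M : ℂ)⁻¹ • (h + algebraMap ℂ C(X, ℂ) δ) with ht
  have htA : t ∈ A := A.sub_mem A.one_mem (A.smul_mem (A.add_mem hh (A.algebraMap_mem _)) _)
  have htx : ∀ x, (M : ℂ) * t x = M - δ - h x := fun x => by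
    have : (M : ℂ) ≠ 0 := by exact_mod_cast hMpos.ne'
    have hconst : algebraMap ℂ C(X, ℂ) δ x = δ := rfl
    simp only [ht, ContinuousMap.sub_apply, ContinuousMap.one_apply, ContinuousMap.smul_apply,
      ContinuousMap.add_apply, hconst, smul_eq_mul]
    field_simp
    ring
  have htn : ‖t‖ < 1 := by
    rw [ContinuousMap.norm_lt_iff _ one_pos]
    intro x
    have h1 : ‖(M : ℂ) - δ - h x‖ ^ 2 < M ^ 2 := by
      rw [← Complex.normSq_eq_norm_sq, Complex.normSq_apply]
      have h2 := h.norm_coe_le_norm x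
      have h3 : (h x).re ^ 2 + (h x).im ^ 2 = ‖h x‖ ^ 2 := by
        rw [← Complex.normSq_eq_norm_sq, Complex.normSq_apply]; ring
      have h4 : ‖h x‖ ^ 2 ≤ ‖h‖ ^ 2 := pow_le_pow_left₀ (norm_nonneg _) h2 2
      simp only [Complex.sub_re, Complex.sub_im, Complex.ofReal_re, Complex.ofReal_im]
      nlinarith [mul_nonneg (sub_nonneg.2 hM0.le) (hre x)]
    rw [← htx, norm_mul, Complex.norm_real, Real.norm_of_nonneg hMpos.le, mul_pow] at h1
    have h5 : ‖t x‖ ^ 2 < 1 := by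
      by_contra! hc
      nlinarith [sq_nonneg M, mul_le_mul_of_nonneg_left hc (sq_nonneg M)]
    nlinarith [norm_nonneg (t x)]
  have : CompleteSpace A := hA.completeSpace_coe
  obtain ⟨u, hu⟩ : IsUnit (1 - (⟨t, htA⟩ : A)) :=
    isUnit_one_sub_of_norm_lt_one (x := (⟨t, htA⟩ : A)) htn
  refine ⟨(M : ℂ)⁻¹ • ((↑u⁻¹ : A) : C(X, ℂ)), A.smul_mem (SetLike.coe_mem _) _, fun x => ?_⟩
  have h1 : ((↑u⁻¹ : A) : C(X, ℂ)) * (1 - t) = 1 := by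
    have := congrArg (Subtype.val) u.inv_mul
    rw [hu] at this
    exact this
  have h2 := DFunLike.congr_fun h1 x
  have : (M : ℂ) ≠ 0 := by exact_mod_cast hMpos.ne'
  simp only [ContinuousMap.mul_apply, ContinuousMap.sub_apply, ContinuousMap.one_apply] at h2
  rw [ContinuousMap.smul_apply, smul_eq_mul, ← h2]
  have h6 := htx x
  field_simp
  linear_combination (((↑u⁻¹ : A) : C(X, ℂ)) x) * h6

/-- The regularization `(F z - F ζ) / ((z - ζ) (F z - F ζ) + δ c(ζ)⁻¹)` of the Cauchy kernel. -/
noncomputable def regKernel (F c : ℂ → ℂ) (δ : ℝ) (ζ z : ℂ) : ℂ :=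
  (F z - F ζ) / ((z - ζ) * (F z - F ζ) + δ * (c ζ)⁻¹)

section regKernel

variable {F c : ℂ → ℂ} {S : Set ℂ} {ζ z : ℂ} {δ : ℝ}

lemma norm_le_norm_add {w : ℂ} (hw : 0 ≤ w.re) (hδ : 0 < δ) : ‖w‖ ≤ ‖w + δ‖ ∧ δ ≤ ‖w + δ‖ := by
  constructor
  · rw [← sq_le_sq₀ (norm_nonneg _) (norm_nonneg _), ← Complex.normSq_eq_norm_sq,
      ← Complex.normSq_eq_norm_sq, Complex.normSq_apply, Complex.normSq_apply]
    simp only [Complex.add_re, Complex.add_im, Complex.ofReal_re, Complex.ofReal_im]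
    nlinarith
  · have := (Complex.re_le_norm (w + δ))
    simp only [Complex.add_re, Complex.ofReal_re] at this
    linarith

lemma regKernel_eq (hc : SupportedAt F S ζ (c ζ)) :
    regKernel F c δ ζ z = c ζ * (F z - F ζ) / (c ζ * (z - ζ) * (F z - F ζ) + δ) := by
  have hc0 : c ζ ≠ 0 := norm_ne_zero_iff.1 (by rw [hc.1]; norm_num)
  rw [regKernel, ← mul_div_mul_left _ _ hc0]
  congr 1
  field_simp

lemma norm_regKernel_le_inv (hc : SupportedAt F S ζ (c ζ)) (hz : z ∈ S) (hδ : 0 < δ)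
    (hne : z ≠ ζ) : ‖regKernel F c δ ζ z‖ ≤ ‖z - ζ‖⁻¹ := by
  obtain ⟨h1, h2⟩ := norm_le_norm_add (hc.2 z hz).1 hδ
  have h0 : 0 < ‖z - ζ‖ := norm_pos_iff.2 (sub_ne_zero.2 hne)
  rw [regKernel_eq hc, norm_div, div_le_iff₀ (hδ.trans_le h2), inv_mul_eq_div, le_div_iff₀ h0]
  refine le_trans (le_of_eq ?_) h1
  simp only [norm_mul]; ring

lemma norm_regKernel_le_div (hc : SupportedAt F S ζ (c ζ)) (hz : z ∈ S) (hδ : 0 < δ) {M : ℝ}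
    (hM : ‖F z - F ζ‖ ≤ M) : ‖regKernel F c δ ζ z‖ ≤ M / δ := by
  obtain ⟨h1, h2⟩ := norm_le_norm_add (hc.2 z hz).1 hδ
  rw [regKernel_eq hc, norm_div, norm_mul, hc.1, one_mul]
  exact div_le_div₀ ((norm_nonneg _).trans hM) hM hδ h2

/-- Near `ζ` the regularized kernel with pole at `q` is still dominated by the Cauchy kernel with
pole at `ζ`, provided `q` is close to `ζ` on the scale of the regularization. -/
lemma norm_regKernel_le_two_mul {q : ℂ} (hc : SupportedAt F S q (c q)) (hz : z ∈ S)
    (hδ : 0 < δ) {M : ℝ} (hM0 : 0 < M) (hM : ‖F z - F q‖ ≤ M) (hq : ‖q - ζ‖ ≤ δ / (2 * M))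
    (hne : z ≠ ζ) : ‖regKernel F c δ q z‖ ≤ 2 * ‖z - ζ‖⁻¹ := by
  have h0 : 0 < ‖z - ζ‖ := norm_pos_iff.2 (sub_ne_zero.2 hne)
  rcases le_or_gt (2 * (δ / (2 * M))) ‖z - ζ‖ with h | h
  · have h1 : ‖z - ζ‖ / 2 ≤ ‖z - q‖ := by
      have : ‖z - ζ‖ ≤ ‖z - q‖ + ‖q - ζ‖ := norm_sub_le_norm_sub_add_norm_sub _ _ _
      linarith
    have hzq : z ≠ q := fun h2 => by rw [h2, sub_self, norm_zero] at h1; rw [h2] at h0; linarith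
    refine (norm_regKernel_le_inv hc hz hδ hzq).trans ?_
    rw [show 2 * ‖z - ζ‖⁻¹ = (‖z - ζ‖ / 2)⁻¹ by field_simp]
    exact inv_anti₀ (by positivity) h1
  · refine (norm_regKernel_le_div hc hz hδ hM).trans ?_
    rw [← div_eq_mul_inv, div_le_div_iff₀ hδ h0]
    have : 2 * (δ / (2 * M)) * M = δ := by field_simp
    nlinarith

end regKernel

lemma exists_mem_eq_regKernel {S : Set ℂ} [CompactSpace S] {A : Subalgebra ℂ C(S, ℂ)}
    (hA : IsClosed (A : Set C(S, ℂ))) {F c : ℂ → ℂ}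
    (hid : (ContinuousMap.id ℂ).restrict S ∈ A) {f : C(S, ℂ)} (hfA : f ∈ A) (hf : ∀ z, f z = F z)
    {ζ : ℂ} (hc : SupportedAt F S ζ (c ζ)) {δ : ℝ} (hδ : 0 < δ) :
    ∃ k ∈ A, ∀ z : S, k z = regKernel F c δ ζ z := by
  set a : C(S, ℂ) := f - algebraMap ℂ C(S, ℂ) (F ζ)
  have haA : a ∈ A := A.sub_mem hfA (A.algebraMap_mem _)
  have hax : ∀ z : S, a z = F z - F ζ := fun z => by simp [a, hf]
  set h : C(S, ℂ) := c ζ • (((ContinuousMap.id ℂ).restrict S - algebraMap ℂ C(S, ℂ) ζ) * a)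
  have hhA : h ∈ A := A.smul_mem (A.mul_mem (A.sub_mem hid (A.algebraMap_mem _)) haA) _
  have hhx : ∀ z : S, h z = c ζ * (z - ζ) * (F z - F ζ) := fun z => by
    simp [h, hax, mul_assoc]
  obtain ⟨k, hkA, hk⟩ := exists_mem_mul_add_eq_one hA hhA
    (fun z => by rw [hhx]; exact (hc.2 z z.2).1) hδ
  refine ⟨c ζ • (k * a), A.smul_mem (A.mul_mem hkA haA) _, fun z => ?_⟩
  have h1 := hk z
  rw [hhx] at h1
  rw [regKernel_eq hc, eq_div_iff (right_ne_zero_of_mul_eq_one h1)]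
  simp only [ContinuousMap.smul_apply, ContinuousMap.mul_apply, hax, smul_eq_mul]
  linear_combination (c ζ * (F z - F ζ)) * h1

lemma exists_simpleFunc_near {S : Set ℂ} (hS : IsCompact S) (hne : S.Nonempty) {η : ℝ}
    (hη : 0 < η) :
    ∃ q : SimpleFunc ℂ ℂ, (∀ ζ, q ζ ∈ S) ∧ ∀ ζ ∈ S, ‖q ζ - ζ‖ ≤ η := by
  have := hne.to_subtype
  set e : ℕ → ℂ := fun n => (TopologicalSpace.denseSeq S n : ℂ)
  obtain ⟨N, hN⟩ := hS.elim_directed_cover (fun N => ⋃ k ≤ N, ball (e k) η)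
    (fun N => isOpen_biUnion fun _ _ => isOpen_ball)
    (fun ζ hζ => by
      obtain ⟨k, hk⟩ := (TopologicalSpace.denseRange_denseSeq S).exists_dist_lt (⟨ζ, hζ⟩ : S) hη
      exact Set.mem_iUnion.2 ⟨k, Set.mem_biUnion (x := k) (le_refl k) (mem_ball.2 hk)⟩)
    (directed_of_isDirected_le fun a b hab =>
      Set.biUnion_subset_biUnion_left fun k hk => le_trans hk hab)
  refine ⟨SimpleFunc.nearestPt e N, fun ζ => ?_, fun ζ hζ => ?_⟩
  · rw [SimpleFunc.nearestPt, SimpleFunc.map_apply]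
    exact Subtype.coe_prop _
  · obtain ⟨k, hk, hkζ⟩ := Set.mem_iUnion₂.1 (hN hζ)
    have := SimpleFunc.edist_nearestPt_le e ζ hk
    rw [edist_dist, edist_dist, ENNReal.ofReal_le_ofReal_iff dist_nonneg] at this
    rw [← dist_eq_norm]
    exact this.trans (by rw [dist_comm]; exact (mem_ball.1 hkζ).le)

/-- Averages of the regularized kernels with discretized poles converge uniformly to the Cauchy
transform of area measure. -/
lemma exists_regKernel_integral_near {r : ℝ} {F c : ℂ → ℂ}
    (hF : ContinuousOn F (closedBall 0 r))
    (hc : ∀ ζ ∈ closedBall (0 : ℂ) r, SupportedAt F (closedBall 0 r) ζ (c ζ))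
    (hnull : ∀ z ∈ closedBall (0 : ℂ) r, volume {ζ ∈ closedBall (0 : ℂ) r | F ζ = F z} = 0)
    {M : ℝ} (hM0 : 0 < M)
    (hM : ∀ z ∈ closedBall (0 : ℂ) r, ∀ w ∈ closedBall (0 : ℂ) r, ‖F z - F w‖ ≤ M)
    (q : ℕ → SimpleFunc ℂ ℂ) (hqS : ∀ n ζ, q n ζ ∈ closedBall (0 : ℂ) r)
    (hq : ∀ n, ∀ ζ ∈ closedBall (0 : ℂ) r, ‖q n ζ - ζ‖ ≤ (1 / ((n : ℝ) + 1)) / (2 * M))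
    {ε : ℝ} (hε : 0 < ε) :
    ∃ n : ℕ, ∀ z ∈ closedBall (0 : ℂ) r,
      ∫ ζ in closedBall (0 : ℂ) r,
        ‖regKernel F c (1 / ((n : ℝ) + 1)) (q n ζ) z - (z - ζ)⁻¹‖ < ε := by
  set D := closedBall (0 : ℂ) r with hD
  have hδ : ∀ n : ℕ, 0 < 1 / ((n : ℝ) + 1) := fun n => by positivity
  set G : ℕ → ℂ → ℂ → ℝ := fun n z => D.indicator
    fun ζ => ‖regKernel F c (1 / ((n : ℝ) + 1)) (q n ζ) z - (z - ζ)⁻¹‖ with hG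
  have hGm : ∀ n z, Measurable (G n z) := fun n z =>
    ((((q n).map fun ζ => regKernel F c (1 / ((n : ℝ) + 1)) ζ z).measurable.sub
      (measurable_const.sub measurable_id).inv).norm).indicator measurableSet_closedBall
  have hint : ∀ (n : ℕ) z, ∫ ζ in D, ‖regKernel F c (1 / ((n : ℝ) + 1)) (q n ζ) z - (z - ζ)⁻¹‖ =
      ∫ w, G n z (z - w) := fun n z => by
    rw [integral_sub_left_eq_self (G n z) volume z, hG, integral_indicator measurableSet_closedBall]
  have hlim : ∀ z₀ ∈ D, Tendsto (fun p : ℕ × ℂ => ∫ w, G p.1 p.2 (p.2 - w))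
      (atTop ×ˢ 𝓝[D] z₀) (𝓝 0) := by
    intro z₀ hz₀
    have hzD : ∀ᶠ p : ℕ × ℂ in atTop ×ˢ 𝓝[D] z₀, p.2 ∈ D :=
      tendsto_snd.eventually self_mem_nhdsWithin
    have hz : Tendsto (fun p : ℕ × ℂ => p.2) (atTop ×ˢ 𝓝[D] z₀) (𝓝 z₀) :=
      tendsto_snd.mono_right nhdsWithin_le_nhds
    have hne0 : ∀ᵐ w : ℂ, w ≠ 0 := compl_mem_ae_iff.2 (measure_singleton 0)
    have hlevel : ∀ᵐ w : ℂ, ¬(z₀ - w ∈ D ∧ F (z₀ - w) = F z₀) :=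
      (Measure.measurePreserving_sub_left volume z₀).quasiMeasurePreserving.ae
        (p := fun ζ => ¬(ζ ∈ D ∧ F ζ = F z₀)) (by
          rw [ae_iff]; simpa only [not_not] using hnull z₀ hz₀)
    have := tendsto_integral_filter_of_dominated_convergence
      (μ := volume) (l := atTop ×ˢ 𝓝[D] z₀) (F := fun (p : ℕ × ℂ) w => G p.1 p.2 (p.2 - w))
      (f := fun _ => (0 : ℝ))
      ((closedBall (0 : ℂ) (2 * r)).indicator fun w => 3 * ‖w‖⁻¹)
      (Eventually.of_forall fun p =>
        ((hGm p.1 p.2).comp (measurable_const.sub measurable_id)).aestronglyMeasurable) ?_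
      ((integrable_indicator_iff measurableSet_closedBall).2
        ((locallyIntegrable_norm_inv.integrableOn_isCompact (isCompact_closedBall _ _)).const_mul 3))
      ?_
    · simpa using this
    · filter_upwards [hzD] with p hp
      filter_upwards [hne0] with w hw
      by_cases hpw : p.2 - w ∈ D
      · have hw2 : w ∈ closedBall (0 : ℂ) (2 * r) := by
          rw [hD, mem_closedBall_zero_iff] at hp hpw
          rw [mem_closedBall_zero_iff]
          calc ‖w‖ = ‖p.2 - (p.2 - w)‖ := by congr 1; ring
            _ ≤ _ := norm_sub_le _ _
            _ ≤ 2 * r := by linarith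
        simp only [hG, Set.indicator_of_mem hpw, Set.indicator_of_mem hw2, norm_norm]
        refine (norm_sub_le _ _).trans ?_
        have h1 := norm_regKernel_le_two_mul (hc _ (hqS p.1 (p.2 - w))) hp (hδ p.1) hM0
          (hM _ hp _ (hqS _ _)) (hq _ _ hpw) (fun h => hw (by linear_combination h))
        rw [sub_sub_cancel] at h1 ⊢
        rw [norm_inv]
        linarith
      · simp only [hG, Set.indicator_of_notMem hpw, norm_zero]
        exact Set.indicator_nonneg (fun _ _ => by positivity) _
    · filter_upwards [hne0, hlevel] with w hw0 hw
      by_cases hwD : z₀ - w ∈ D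
      · have hFne : F z₀ - F (z₀ - w) ≠ 0 := fun h => hw ⟨hwD, (sub_eq_zero.1 h).symm⟩
        have hzw : Tendsto (fun p : ℕ × ℂ => p.2 - w) (atTop ×ˢ 𝓝[D] z₀) (𝓝 (z₀ - w)) :=
          hz.sub_const w
        have hδ0 : Tendsto (fun p : ℕ × ℂ => 1 / ((p.1 : ℝ) + 1)) (atTop ×ˢ 𝓝[D] z₀) (𝓝 0) :=
          tendsto_one_div_add_atTop_nhds_zero_nat.comp tendsto_fst
        classical
        simp only [hG, Set.indicator_apply]
        refine Tendsto.if ?_ tendsto_const_nhds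
        set L := (atTop ×ˢ 𝓝[D] z₀) ⊓ 𝓟 {p : ℕ × ℂ | p.2 - w ∈ D}
        have hL : L ≤ atTop ×ˢ 𝓝[D] z₀ := inf_le_left
        have hLD : ∀ᶠ p in L, p.2 - w ∈ D := mem_inf_of_right (mem_principal_self _)
        have hqw : Tendsto (fun p : ℕ × ℂ => q p.1 (p.2 - w)) L (𝓝 (z₀ - w)) := by
          have h0 : Tendsto (fun p : ℕ × ℂ => q p.1 (p.2 - w) - (p.2 - w)) L (𝓝 0) :=
            squeeze_zero_norm' (hLD.mono fun p hp => hq p.1 _ hp)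
              (by simpa using (hδ0.mono_left hL).div_const (2 * M))
          simpa using h0.add (hzw.mono_left hL)
        have hFq : Tendsto (fun p : ℕ × ℂ => F (q p.1 (p.2 - w))) L (𝓝 (F (z₀ - w))) :=
          (hF _ hwD).tendsto.comp
            (tendsto_nhdsWithin_iff.2 ⟨hqw, Eventually.of_forall fun p => hqS _ _⟩)
        have hFz : Tendsto (fun p : ℕ × ℂ => F p.2) L (𝓝 (F z₀)) :=
          ((hF _ hz₀).tendsto.comp tendsto_snd).mono_left hL
        have hcq : Tendsto (fun p : ℕ × ℂ => ((1 / ((p.1 : ℝ) + 1) : ℝ) : ℂ) *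
            (c (q p.1 (p.2 - w)))⁻¹) L (𝓝 0) := by
          refine squeeze_zero_norm (fun p => ?_) (hδ0.mono_left hL)
          rw [norm_mul, norm_inv, (hc _ (hqS _ _)).1, inv_one, mul_one, Complex.norm_real,
            Real.norm_of_nonneg (hδ _).le]
        have hden := (((hz.mono_left hL).sub hqw).mul (hFz.sub hFq)).add hcq
        rw [sub_sub_cancel, add_zero] at hden
        have hker := (hFz.sub hFq).div hden (mul_ne_zero hw0 hFne)
        rw [div_mul_cancel_right₀ hFne] at hker
        have hsub := (hker.sub_const w⁻¹).norm
        rw [sub_self, norm_zero] at hsub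
        simp only [sub_sub_cancel]
        exact hsub
      · have h1 : ∀ᶠ p : ℕ × ℂ in atTop ×ˢ 𝓝[D] z₀, p.2 - w ∈ Dᶜ :=
          (hz.sub_const w).eventually (isClosed_closedBall.isOpen_compl.mem_nhds hwD)
        exact tendsto_const_nhds.congr' (h1.mono fun p hp =>
          (Set.indicator_of_notMem hp _).symm)
  have hunif : TendstoUniformlyOn (fun n z => ∫ w, G n z (z - w)) (fun _ => (0 : ℝ)) atTop D := by
    rw [← tendstoLocallyUniformlyOn_iff_tendstoUniformlyOn_of_compact (isCompact_closedBall _ _),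
      tendstoLocallyUniformlyOn_iff_filter]
    intro z₀ hz₀
    rw [Metric.tendstoUniformlyOnFilter_iff]
    intro e he
    filter_upwards [(Metric.tendsto_nhds.1 (hlim z₀ hz₀)) e he] with p hp
    rwa [dist_comm]
  obtain ⟨n, hn⟩ := ((Metric.tendstoUniformlyOn_iff.1 hunif) ε hε).exists
  refine ⟨n, fun z hz => ?_⟩
  have := hn z hz
  rw [← hint, dist_zero_left, Real.norm_eq_abs] at this
  exact (le_abs_self _).trans_lt this

/-- A closed subalgebra of `C(D, ℂ)` containing `z` and a function with the support property also
contains the function `z ↦ conj z`. -/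
lemma star_id_mem_of_supportedAt {r : ℝ} (hr : 0 < r) {F : ℂ → ℂ}
    (hF : ContinuousOn F (closedBall 0 r))
    (hsup : ∀ ζ ∈ closedBall (0 : ℂ) r, ∃ C, SupportedAt F (closedBall 0 r) ζ C)
    (hnull : ∀ z ∈ closedBall (0 : ℂ) r, volume {ζ ∈ closedBall (0 : ℂ) r | F ζ = F z} = 0)
    [CompactSpace (closedBall (0 : ℂ) r)] {A : Subalgebra ℂ C(closedBall (0 : ℂ) r, ℂ)}
    (hA : IsClosed (A : Set C(closedBall (0 : ℂ) r, ℂ)))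
    (hid : (ContinuousMap.id ℂ).restrict (closedBall 0 r) ∈ A)
    {f : C(closedBall (0 : ℂ) r, ℂ)} (hfA : f ∈ A) (hf : ∀ z, f z = F z) :
    star ((ContinuousMap.id ℂ).restrict (closedBall 0 r)) ∈ A := by
  have h0D : (0 : ℂ) ∈ closedBall (0 : ℂ) r := mem_closedBall_self hr.le
  choose! c hc using hsup
  obtain ⟨N, hN⟩ := (isCompact_closedBall (0 : ℂ) r).exists_bound_of_continuousOn hF
  have hN0 : 0 ≤ N := (norm_nonneg _).trans (hN 0 h0D)
  have hM : ∀ z ∈ closedBall (0 : ℂ) r, ∀ w ∈ closedBall (0 : ℂ) r, ‖F z - F w‖ ≤ 2 * N + 1 :=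
    fun z hz w hw => (norm_sub_le _ _).trans (by linarith [hN z hz, hN w hw])
  choose q hqS hq using fun n : ℕ => exists_simpleFunc_near (isCompact_closedBall (0 : ℂ) r)
    ⟨0, h0D⟩ (show 0 < (1 / ((n : ℝ) + 1)) / (2 * (2 * N + 1)) by positivity)
  have hvol : volume (closedBall (0 : ℂ) r) ≠ ⊤ := measure_closedBall_lt_top.ne
  have hvol0 : volume (closedBall (0 : ℂ) r) ≠ 0 := (measure_closedBall_pos volume _ hr).ne'
  have : IsFiniteMeasure (volume.restrict (closedBall (0 : ℂ) r)) := ⟨by simpa using hvol.lt_top⟩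
  refine hA.closure_subset (Metric.mem_closure_iff.2 fun ε hε => ?_)
  obtain ⟨n, hn⟩ := exists_regKernel_integral_near hF hc hnull (by positivity) hM q hqS hq
    (mul_pos Real.pi_pos hε)
  set δ : ℝ := 1 / ((n : ℝ) + 1)
  have hδ : 0 < δ := by positivity
  choose! k hkA hk using fun (ζ : ℂ) (hζ : ζ ∈ closedBall (0 : ℂ) r) =>
    exists_mem_eq_regKernel hA hid hfA hf (hc ζ hζ) hδ
  have hki : IntegrableOn ((q n).map k) (closedBall 0 r) :=
    SimpleFunc.integrable_of_isFiniteMeasure _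
  have hmem : ∫ ζ in closedBall (0 : ℂ) r, (q n).map k ζ ∈ A := by
    rw [← measure_smul_setAverage _ hvol]
    exact (A.toSubmodule.restrictScalars ℝ).smul_mem _
      ((A.toSubmodule.restrictScalars ℝ).convex.set_average_mem hA hvol0 hvol
        (Eventually.of_forall fun ζ => hkA _ (hqS n ζ)) hki)
  refine ⟨(Real.pi : ℂ)⁻¹ • ∫ ζ in closedBall (0 : ℂ) r, (q n).map k ζ, A.smul_mem hmem _, ?_⟩
  rw [dist_comm, ContinuousMap.dist_lt_iff hε]
  intro z
  have hz : ‖(z : ℂ)‖ ≤ r := mem_closedBall_zero_iff.1 z.2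
  have hri : IntegrableOn (fun ζ => regKernel F c δ (q n ζ) z) (closedBall 0 r) :=
    ((q n).map fun ζ => regKernel F c δ ζ z).integrable_of_isFiniteMeasure
  have hval : (∫ ζ in closedBall (0 : ℂ) r, (q n).map k ζ) z =
      ∫ ζ in closedBall (0 : ℂ) r, regKernel F c δ (q n ζ) z := by
    rw [ContinuousMap.integral_apply hki]
    exact integral_congr_ae (Eventually.of_forall fun ζ => hk _ (hqS n ζ) z)
  have hπ : (Real.pi : ℂ) ≠ 0 := by exact_mod_cast Real.pi_ne_zero
  have hdiff : Real.pi * (((Real.pi : ℂ)⁻¹ • ∫ ζ in closedBall (0 : ℂ) r, (q n).map k ζ) z -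
      (starRingEnd ℂ) z) =
      ∫ ζ in closedBall (0 : ℂ) r, (regKernel F c δ (q n ζ) z - (z - ζ)⁻¹) := by
    rw [integral_sub hri (integrableOn_cauchyKernel _ _), integral_cauchyKernel hz, ← hval,
      ContinuousMap.smul_apply, smul_eq_mul]
    field_simp
  have hlt := (norm_integral_le_integral_norm _).trans_lt (hn z z.2)
  rw [← hdiff, norm_mul, Complex.norm_real, Real.norm_of_nonneg Real.pi_pos.le] at hlt
  rw [dist_eq_norm]
  exact lt_of_mul_lt_mul_left hlt Real.pi_pos.le

/-- Proposition 1.3 (second part): if additionally `F ∈ C¹(D̄)` and the zero set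
of `∂F/∂z̄` is nowhere dense and finitely connected, then `[z, F]_{D̄} = C(D̄)`. -/
theorem holder_uniform_approx_simple (r α K ν : ℝ) (hr : 0 < r)
    (hα0 : 0 < α) (hα1 : α < 1)
    (F : ℂ → ℂ) (E : Set ℂ)
    (hF : HolderOn F α (closedBall 0 r))
    (hE : E ⊆ closedBall 0 r) (hEnd : IsNowhereDense E)
    (hK : 0 < K) (hν : 1 ≤ ν)
    (hyp : ∀ ζ ∈ closedBall (0 : ℂ) r \ E,
      ∃ C : ℂ, ‖C‖ = 1 ∧
        ∀ z ∈ closedBall (0 : ℂ) r,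
          C * (z - ζ) * (F z - F ζ) ∈ wedge K ν)
    -- `F ∈ C¹(D̄)`, with (continuous) real Fréchet derivative `F'`:
    (F' : ℂ → ℂ →L[ℝ] ℂ)
    (hF' : ∀ z ∈ closedBall (0 : ℂ) r, HasFDerivWithinAt F (F' z) (closedBall 0 r) z)
    (hF'c : ContinuousOn F' (closedBall 0 r))
    (hLnd : IsNowhereDense {z ∈ closedBall (0 : ℂ) r | dbar F' z = 0})
    (hLfc : FinitelyConnected {z ∈ closedBall (0 : ℂ) r | dbar F' z = 0}) :
    ∀ g : ℂ → ℂ, ContinuousOn g (closedBall 0 r) → ∀ ε > 0,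
      ∃ P : MvPolynomial (Fin 2) ℂ, ∀ z ∈ closedBall (0 : ℂ) r,
        ‖g z - MvPolynomial.eval ![z, F z] P‖ < ε := by
  have hFc : ContinuousOn F (closedBall 0 r) := fun z hz => (hF' z hz).continuousWithinAt
  have hsup : ∀ ζ ∈ closedBall (0 : ℂ) r, ∃ C, SupportedAt F (closedBall 0 r) ζ C :=
    fun ζ hζ => exists_supportedAt hν hFc hyp hζ (closedBall_subset_closure_sdiff hr hEnd hζ)
  have : CompactSpace (closedBall (0 : ℂ) r) :=
    isCompact_iff_compactSpace.1 (isCompact_closedBall 0 r)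
  set x : C(closedBall (0 : ℂ) r, ℂ) := (ContinuousMap.id ℂ).restrict (closedBall 0 r)
  set f : C(closedBall (0 : ℂ) r, ℂ) := ⟨(closedBall 0 r).domRestrict F, hFc.domRestrict⟩
  set A := (Algebra.adjoin ℂ (Set.range ![x, f])).topologicalClosure with hA
  have hsub : ∀ i, ![x, f] i ∈ A := fun i =>
    Subalgebra.le_topologicalClosure _ (Algebra.subset_adjoin (Set.mem_range_self i))
  have hstar : star x ∈ A :=
    star_id_mem_of_supportedAt hr hFc hsup
      (fun z _ => volume_level_eq_zero isClosed_closedBall hFc hsup (F z)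
        (level_subset_closure hr hF' hLnd (F z)))
      (Subalgebra.isClosed_topologicalClosure _) (hsub 0) (hsub 1) fun _ => rfl
  have htop : ∀ g : C(closedBall (0 : ℂ) r, ℂ), g ∈ A := fun g => by
    have hg : g ∈ StarAlgebra.elemental ℂ x := by
      rw [ContinuousMap.elemental_id_eq_top]; trivial
    refine (Subalgebra.topologicalClosure_minimal
      (s := (StarAlgebra.adjoin ℂ {x}).toSubalgebra) ?_
      (Subalgebra.isClosed_topologicalClosure _)) hg
    rw [StarAlgebra.adjoin_toSubalgebra, Algebra.adjoin_le_iff]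
    simp only [Set.star_singleton, Set.union_subset_iff, Set.singleton_subset_iff]
    exact ⟨hsub 0, hstar⟩
  intro g hg ε hε
  obtain ⟨p, hp, hgp⟩ := Metric.mem_closure_iff.1
    (htop ⟨(closedBall 0 r).domRestrict g, hg.domRestrict⟩) ε hε
  rw [SetLike.mem_coe, Algebra.adjoin_range_eq_range_aeval] at hp
  obtain ⟨P, rfl⟩ := hp
  refine ⟨P, fun z hz => ?_⟩
  have h1 := (ContinuousMap.dist_lt_iff hε).1 hgp ⟨z, hz⟩
  have h2 : (MvPolynomial.aeval ![x, f] P) ⟨z, hz⟩ = MvPolynomial.eval ![z, F z] P := by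
    have h3 := MvPolynomial.comp_aeval_apply (f := ![x, f])
      (ContinuousMap.evalAlgHom ℂ ℂ (⟨z, hz⟩ : closedBall (0 : ℂ) r)) P
    refine h3.trans ?_
    rw [MvPolynomial.aeval_eq_eval]
    congr 2
    ext i
    fin_cases i <;> rfl
  rw [← h2, ← dist_eq_norm]
  exact h1
end

section
/- Let D̄ be a closed disc in ℂ with centre 0, let F : D̄ → ℂ be continuous, and let ζ ∈ D̄. Suppose there exist a constant p ≥ 2, a nowhere-vanishing function A ∈ 𝒪(D̄), and functions G, H ∈ 𝒪_ζ(D̄) such that |A(z)F(z) − A(ζ)F(ζ) + G(z)|^p ≤ Re[H(z)·(A(z)F(z) − A(ζ)F(ζ) + G(z))] for all z ∈ D̄. Then the polynomially convex hull of Graph_{D̄}(F) is contained in {(z, w) ∈ D̄ × ℂ : |A(z)w − A(ζ)F(ζ) + G(z)| ≤ |H(z)|^{1/(p−1)}}. -/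
open Complex Metric

noncomputable def pEval (x : ℂ × ℂ) (p : MvPolynomial (Fin 2) ℂ) : ℂ :=
  MvPolynomial.eval ![x.1, x.2] p

/-- The polynomially convex hull of a set in `ℂ²`. -/
noncomputable def polyHull (X : Set (ℂ × ℂ)) : Set (ℂ × ℂ) :=
  {x | ∀ p : MvPolynomial (Fin 2) ℂ, ‖pEval x p‖ ≤ ⨆ y ∈ X, ‖pEval y p‖}

def graphOn (S : Set ℂ) (F : ℂ → ℂ) : Set (ℂ × ℂ) := {q | q.1 ∈ S ∧ q.2 = F q.1}

/-- Membership in `𝒪(S)`: holomorphic on some open neighbourhood of `S`. -/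
def HoloNear (A : ℂ → ℂ) (S : Set ℂ) : Prop :=
  ∃ U : Set ℂ, IsOpen U ∧ S ⊆ U ∧ DifferentiableOn ℂ A U

/-- The closure, in the continuous functions on `K ⊆ ℂ²`, of the polynomials. -/
noncomputable def polyClosure (K : Set (ℂ × ℂ)) [CompactSpace K] : Subalgebra ℂ C(K, ℂ) :=
  (MvPolynomial.aeval (R := ℂ)
    ![(⟨fun y => y.1.1, by fun_prop⟩ : C(K, ℂ)),
      ⟨fun y => y.1.2, by fun_prop⟩]).range.topologicalClosure

theorem aeval_coord_apply {K : Set (ℂ × ℂ)} [CompactSpace K] (q : MvPolynomial (Fin 2) ℂ) (y : K) :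
    MvPolynomial.aeval (R := ℂ)
      ![(⟨fun y => y.1.1, by fun_prop⟩ : C(K, ℂ)), ⟨fun y => y.1.2, by fun_prop⟩] q y =
      pEval y q := by
  rw [pEval]
  induction q using MvPolynomial.induction_on with
  | C a => simp [Algebra.algebraMap_eq_smul_one]
  | add f g hf hg => simp [hf, hg]
  | mul_X f i hf =>
    rw [map_mul, map_mul, ContinuousMap.mul_apply, hf]
    fin_cases i <;> simp

theorem fst_mem_polyClosure (K : Set (ℂ × ℂ)) [CompactSpace K] :
    (⟨fun y => y.1.1, by fun_prop⟩ : C(K, ℂ)) ∈ polyClosure K :=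
  Subalgebra.le_topologicalClosure _ ⟨MvPolynomial.X 0, by simp⟩

theorem snd_mem_polyClosure (K : Set (ℂ × ℂ)) [CompactSpace K] :
    (⟨fun y => y.1.2, by fun_prop⟩ : C(K, ℂ)) ∈ polyClosure K :=
  Subalgebra.le_topologicalClosure _ ⟨MvPolynomial.X 1, by simp⟩

/-- Polynomial bounds pass to the polynomially convex hull. -/
theorem norm_pEval_le_of_mem_polyHull {X : Set (ℂ × ℂ)} {x : ℂ × ℂ} (hx : x ∈ polyHull X)
    (q : MvPolynomial (Fin 2) ℂ) {M : ℝ} (hM : 0 ≤ M) (h : ∀ y ∈ X, ‖pEval y q‖ ≤ M) :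
    ‖pEval x q‖ ≤ M :=
  (hx q).trans (Real.iSup_le (fun y => Real.iSup_le (h y) hM) hM)

/-- Bounds on uniform limits of polynomials pass to the polynomially convex hull. -/
theorem norm_le_of_mem_polyHull {X K : Set (ℂ × ℂ)} [CompactSpace K] (hXK : X ⊆ K) (x : K)
    (hx : x.1 ∈ polyHull X) {f : C(K, ℂ)} (hf : f ∈ polyClosure K) {M : ℝ} (hM : 0 ≤ M)
    (h : ∀ y : K, y.1 ∈ X → ‖f y‖ ≤ M) : ‖f x‖ ≤ M := by
  refine le_of_forall_pos_le_add fun ε hε => ?_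
  obtain ⟨_, ⟨q, rfl⟩, hq⟩ := Metric.mem_closure_iff.1 hf (ε / 2) (half_pos hε)
  have hd : ∀ y : K, ‖f y - pEval y q‖ ≤ ε / 2 := fun y => by
    rw [← aeval_coord_apply, ← dist_eq_norm]
    exact (ContinuousMap.dist_apply_le_dist y).trans hq.le
  have hb : ‖pEval x q‖ ≤ M + ε / 2 := by
    refine norm_pEval_le_of_mem_polyHull hx q (by positivity) fun y hy => ?_
    have h1 := h ⟨y, hXK hy⟩ hy
    have h2 := hd ⟨y, hXK hy⟩
    have h3 := norm_sub_norm_le (pEval y q) (f ⟨y, hXK hy⟩)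
    rw [norm_sub_rev] at h3
    linarith
  have h2 := hd x
  have h3 := norm_sub_norm_le (f x) (pEval x q)
  linarith

/-- A function holomorphic near a closed disc is a uniform limit of polynomials there. -/
theorem HoloNear.exists_mem_polyClosure {f : ℂ → ℂ} {r : ℝ} (hr : 0 < r)
    (hf : HoloNear f (closedBall 0 r)) {K : Set (ℂ × ℂ)} [CompactSpace K]
    (hK : ∀ y ∈ K, y.1 ∈ closedBall (0 : ℂ) r) :
    ∃ g ∈ polyClosure K, ∀ y, g y = f y.1.1 := by
  obtain ⟨U, hU, hrU, hfU⟩ := hf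
  obtain ⟨δ, hδ, hδU⟩ := (isCompact_closedBall (0 : ℂ) r).exists_cthickening_subset_open hU hrU
  rw [cthickening_closedBall hδ.le hr.le] at hδU
  obtain ⟨t, hrt, htR⟩ := exists_between (lt_add_of_pos_left r hδ)
  have ht : 0 < t := hr.trans hrt
  have hR : 0 < δ + r := ht.trans htR
  have hcont : ContinuousOn f (closedBall 0 r) := hfU.continuousOn.mono hrU
  let g : C(K, ℂ) := ⟨fun y => f y.1.1, hcont.comp_continuous (by fun_prop) fun y => hK y y.2⟩
  refine ⟨g, ?_, fun _ => rfl⟩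
  lift δ + r to NNReal using hR.le with R hRe
  lift t to NNReal using ht.le
  have hps := (hfU.mono hδU).hasFPowerSeriesOnBall (by exact_mod_cast hR)
  set P := cauchyPowerSeries f 0 R
  have hlim := hps.tendstoUniformlyOn (r' := t) (by exact_mod_cast htR)
  let Z : C(K, ℂ) := ⟨fun y => y.1.1, by fun_prop⟩
  let S : ℕ → C(K, ℂ) := fun n => ∑ k ∈ Finset.range n, P.coeff k • Z ^ k
  have hS : Filter.Tendsto S Filter.atTop (nhds g) := by
    rw [ContinuousMap.tendsto_iff_tendstoUniformly, Metric.tendstoUniformly_iff]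
    intro ε hε
    filter_upwards [Metric.tendstoUniformlyOn_iff.1 hlim ε hε] with n hn y
    have hy : (y : ℂ × ℂ).1 ∈ ball (0 : ℂ) t := closedBall_subset_ball hrt (hK y y.2)
    have h := hn y.1.1 hy
    rw [zero_add] at h
    have hSn : S n y = P.partialSum n y.1.1 := by
      simp [S, Z, FormalMultilinearSeries.partialSum, mul_comm]
    rwa [hSn]
  refine (Subalgebra.isClosed_topologicalClosure _).mem_of_tendsto hS (.of_forall fun n => ?_)
  exact sum_mem fun k _ => (polyClosure K).smul_mem ((polyClosure K).pow_mem
    (fst_mem_polyClosure K) k) _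

theorem exp_comp_mem_polyClosure {K : Set (ℂ × ℂ)} [CompactSpace K] {f : C(K, ℂ)}
    (hf : f ∈ polyClosure K) : ∃ g ∈ polyClosure K, ∀ y, g y = exp (f y) := by
  refine ⟨NormedSpace.exp f, ?_, fun y => ?_⟩
  · exact NormedSpace.exp_mem (s := polyClosure K) (Subalgebra.isClosed_topologicalClosure _) hf
  · rw [exp_eq_exp_ℂ]
    exact NormedSpace.map_exp (ContinuousMap.evalAlgHom ℂ ℂ y) (continuous_eval_const y) f

/-- The tangent line inequality for `t ↦ t ^ p`. -/
theorem mul_rpow_sub_one_mul_le {p a t : ℝ} (hp : 1 ≤ p) (ha : 0 < a) (ht : 0 ≤ t) :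
    p * a ^ (p - 1) * t ≤ (p - 1) * a ^ p + t ^ p := by
  have hb := one_add_mul_self_le_rpow_one_add (s := t / a - 1)
    (by have : 0 ≤ t / a := by positivity
        linarith) hp
  rw [add_sub_cancel, Real.div_rpow ht ha.le, le_div_iff₀ (by positivity)] at hb
  rw [Real.rpow_sub_one ha.ne']
  have : (1 + p * (t / a - 1)) * a ^ p = a ^ p - p * a ^ p + p * (a ^ p / a) * t := by
    field_simp
    ring
  linarith

/-- Proposition 1.5 (the key proposition). -/
theorem key_prop_hull_pinch (r p : ℝ) (hr : 0 < r) (hp : 2 ≤ p)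
    (F A G H : ℂ → ℂ) (ζ : ℂ) (hζ : ζ ∈ closedBall (0 : ℂ) r)
    (hF : ContinuousOn F (closedBall 0 r))
    (hA : HoloNear A (closedBall 0 r))
    (hA0 : ∀ z ∈ closedBall (0 : ℂ) r, A z ≠ 0)
    (hG : HoloNear G (closedBall 0 r)) (hGζ : G ζ = 0)
    (hH : HoloNear H (closedBall 0 r)) (hHζ : H ζ = 0)
    (hineq : ∀ z ∈ closedBall (0 : ℂ) r,
      ‖A z * F z - A ζ * F ζ + G z‖ ^ p ≤
        (H z * (A z * F z - A ζ * F ζ + G z)).re) :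
    polyHull (graphOn (closedBall 0 r) F) ⊆
      {q : ℂ × ℂ | q.1 ∈ closedBall (0 : ℂ) r ∧
        ‖A q.1 * q.2 - A ζ * F ζ + G q.1‖ ≤ ‖H q.1‖ ^ (1 / (p - 1))} := by
  rintro x hx
  have hx1 : x.1 ∈ closedBall (0 : ℂ) r := by
    rw [mem_closedBall_zero_iff]
    simpa [pEval] using norm_pEval_le_of_mem_polyHull hx (MvPolynomial.X 0) hr.le
      fun y hy => by simpa [pEval] using hy.1
  refine ⟨hx1, ?_⟩
  set X := graphOn (closedBall 0 r) F
  have hXc : IsCompact X := by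
    have : X = (fun z => (z, F z)) '' closedBall (0 : ℂ) r := by
      ext ⟨z, w⟩
      simp [X, graphOn, eq_comm]
    rw [this]
    exact (isCompact_closedBall _ _).image_of_continuousOn (continuousOn_id.prodMk hF)
  have hKc : IsCompact (insert x X) := hXc.insert x
  have : CompactSpace (insert x X : Set (ℂ × ℂ)) := isCompact_iff_compactSpace.1 hKc
  have hK : ∀ y ∈ insert x X, y.1 ∈ closedBall (0 : ℂ) r := by
    rintro y (rfl | hy)
    exacts [hx1, hy.1]
  obtain ⟨A', hA', hAe⟩ := hA.exists_mem_polyClosure hr hK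
  obtain ⟨G', hG', hGe⟩ := hG.exists_mem_polyClosure hr hK
  obtain ⟨H', hH', hHe⟩ := hH.exists_mem_polyClosure hr hK
  set Φ₀ := A x.1 * x.2 - A ζ * F ζ + G x.1
  rcases (norm_nonneg Φ₀).eq_or_lt with h0 | h0
  · rw [← h0]
    positivity
  set a := ‖Φ₀‖ with ha
  let c : ℂ := (p * a ^ (p - 2) : ℝ) * (starRingEnd ℂ) Φ₀
  have hpa : a ^ (p - 2) * a = a ^ (p - 1) := by
    rw [← Real.rpow_add_one h0.ne']
    ring_nf
  have hpa' : a ^ (p - 1) * a = a ^ p := by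
    rw [← Real.rpow_add_one h0.ne']
    ring_nf
  have hc : ‖c‖ = p * a ^ (p - 1) := by
    rw [norm_mul, RCLike.norm_conj, Complex.norm_real, Real.norm_of_nonneg (by positivity), ← hpa]
    ring
  have hcΦ : (c * Φ₀).re = p * a ^ p := by
    have : c * Φ₀ = ((p * a ^ (p - 2) * a ^ 2 : ℝ) : ℂ) := by
      rw [mul_assoc, Complex.conj_mul']
      push_cast
      rfl
    rw [this, ofReal_re, ← hpa', ← hpa]
    ring
  set B := polyClosure (insert x X)
  obtain ⟨E, hE, hEe⟩ := exp_comp_mem_polyClosure (K := insert x X)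
    (B.mul_mem (B.sub_mem (B.algebraMap_mem c) hH')
      (B.add_mem (B.sub_mem (B.mul_mem hA' (snd_mem_polyClosure _))
        (B.algebraMap_mem (A ζ * F ζ))) hG'))
  have hEn : ∀ y, ‖E y‖ = Real.exp
      ((c - H y.1.1) * (A y.1.1 * y.1.2 - A ζ * F ζ + G y.1.1)).re := fun y => by
    rw [hEe, Complex.norm_exp]
    simp [hAe, hGe, hHe, Algebra.algebraMap_eq_smul_one]
  have key := norm_le_of_mem_polyHull (Set.subset_insert x X) ⟨x, Set.mem_insert x X⟩ hx hE
    (Real.exp_pos ((p - 1) * a ^ p)).le fun y hy => by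
      rw [hEn, Real.exp_le_exp]
      obtain ⟨hy1, hy2⟩ := hy
      rw [hy2, sub_mul, sub_re]
      have h1 := hineq _ hy1
      have h2 := (re_le_norm (c * (A y.1.1 * F y.1.1 - A ζ * F ζ + G y.1.1)))
      rw [norm_mul, hc] at h2
      have h3 := mul_rpow_sub_one_mul_le (by linarith : 1 ≤ p) h0
        (norm_nonneg (A y.1.1 * F y.1.1 - A ζ * F ζ + G y.1.1))
      linarith
  rw [hEn, Real.exp_le_exp] at key
  change ((c - H x.1) * Φ₀).re ≤ _ at key
  rw [sub_mul, sub_re, hcΦ] at key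
  have h4 := re_le_norm (H x.1 * Φ₀)
  rw [norm_mul, ← ha] at h4
  have h5 : a ^ (p - 1) ≤ ‖H x.1‖ := by
    refine le_of_mul_le_mul_right ?_ h0
    rw [hpa']
    linarith
  rw [one_div, Real.le_rpow_inv_iff_of_pos h0.le (norm_nonneg _) (by linarith)]
  exact h5
end

section
/- Let D̄ be a closed disc in ℂ with centre 0, let m ≥ 2 be an integer, let α ∈ (0, 1), and let R ∈ C¹(D̄) (in the real sense) satisfy |R(z) − R(ζ)| < α|z^m − ζ^m| for all z, ζ ∈ D̄ with z^m ≠ ζ^m. Define F(z) := z̄^m + R(z) for z ∈ D̄. Then [z, F]_{D̄} = C(D̄): every continuous complex-valued function on D̄ is a uniform limit on D̄ of polynomials in z and F(z). -/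
open Complex Metric

section

open MeasureTheory Set Real Filter Topology

section InverseMem

variable {K : Type*} [TopologicalSpace K] [CompactSpace K]

/-- In a closed subalgebra of `C(K, ℂ)`, an element whose real part is bounded below by a positive
constant is invertible. -/
theorem exists_inverse_mem_of_re_pos {A : Subalgebra ℂ C(K, ℂ)} (hA : IsClosed (A : Set C(K, ℂ)))
    {a : C(K, ℂ)} (ha : a ∈ A) {δ : ℝ} (hδ : 0 < δ) (h : ∀ x, δ ≤ (a x).re) :
    ∃ b ∈ A, a * b = 1 := by
  have : CompleteSpace A := hA.completeSpace_coe
  set M := ‖a‖ with hM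
  set t : ℝ := (M ^ 2 + 1) / δ with ht
  have ht0 : 0 < t := by positivity
  have htδ : t * δ = M ^ 2 + 1 := by rw [ht]; field_simp
  have hn : ‖(1 : C(K, ℂ)) - (t⁻¹ : ℂ) • a‖ < 1 := by
    rw [ContinuousMap.norm_lt_iff _ one_pos]
    intro x
    have h1 : ‖a x‖ ≤ M := a.norm_coe_le_norm x
    have h2 : t * δ ≤ t * (a x).re := mul_le_mul_of_nonneg_left (h x) ht0.le
    have h3 : ‖(t : ℂ) - a x‖ < t := by
      refine lt_of_pow_lt_pow_left₀ 2 ht0.le ?_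
      have h4 : ‖a x‖ ^ 2 ≤ M ^ 2 := by gcongr
      rw [← normSq_eq_norm_sq, normSq_apply] at h4 ⊢
      simp only [sub_re, ofReal_re, sub_im, ofReal_im]
      nlinarith [sq_nonneg M]
    have h4 : (1 : ℂ) - (t : ℂ)⁻¹ * a x = (t : ℂ)⁻¹ * (t - a x) := by
      have : (t : ℂ) ≠ 0 := by exact_mod_cast ht0.ne'
      field_simp
    simp only [ContinuousMap.sub_apply, ContinuousMap.one_apply, ContinuousMap.smul_apply,
      smul_eq_mul]
    rw [h4, norm_mul, norm_inv, Complex.norm_of_nonneg ht0.le, inv_mul_lt_one₀ ht0]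
    exact h3
  have hu : IsUnit (1 - ((1 : A) - (t⁻¹ : ℂ) • ⟨a, ha⟩)) := isUnit_one_sub_of_norm_lt_one hn
  obtain ⟨b, hb⟩ := hu.exists_right_inv
  refine ⟨(t⁻¹ : ℂ) • b, A.smul_mem b.2 _, ?_⟩
  have := congrArg (Subtype.val : A → C(K, ℂ)) hb
  simpa using this

/-- The inverse of `exists_inverse_mem_of_re_pos` is `Ring.inverse`, computed pointwise. -/
theorem inverse_mem_of_re_pos {A : Subalgebra ℂ C(K, ℂ)} (hA : IsClosed (A : Set C(K, ℂ)))
    {a : C(K, ℂ)} (ha : a ∈ A) {δ : ℝ} (hδ : 0 < δ) (h : ∀ x, δ ≤ (a x).re) :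
    IsUnit a ∧ Ring.inverse a ∈ A ∧ ∀ x, Ring.inverse a x = (a x)⁻¹ := by
  obtain ⟨b, hb, hab⟩ := exists_inverse_mem_of_re_pos hA ha hδ h
  have hu : IsUnit a := IsUnit.of_mul_eq_one b hab
  have hinv : Ring.inverse a = b := by
    rw [← mul_one (Ring.inverse a), ← hab, ← mul_assoc, Ring.inverse_mul_cancel a hu, one_mul]
  refine ⟨hu, hinv ▸ hb, fun x => ?_⟩
  rw [hinv]
  exact eq_inv_of_mul_eq_one_right (by simpa using congrArg (fun f => f x) hab)

end InverseMem

theorem setIntegral_mem_of_isClosed {E : Type*} [NormedAddCommGroup E] [NormedSpace ℝ E]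
    [CompleteSpace E] {X : Type*} [MeasurableSpace X] {μ : Measure X} {s : Set X}
    (hs : MeasurableSet s) (S : Submodule ℝ E)
    (hS : IsClosed (S : Set E)) {k : X → E} (hk : ∀ x ∈ s, k x ∈ S) (hμ : μ s ≠ ⊤)
    (hi : IntegrableOn k s μ) : ∫ x in s, k x ∂μ ∈ S := by
  rcases eq_or_ne (μ s) 0 with h0 | h0
  · rw [setIntegral_measure_zero _ h0]; exact S.zero_mem
  · have h := S.convex.set_average_mem hS h0 hμ
      ((ae_restrict_iff' hs).2 (ae_of_all _ hk)) hi
    rw [setAverage_eq] at h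
    have h1 : μ.real s ≠ 0 := (ENNReal.toReal_pos h0 hμ).ne'
    simpa [smul_smul, h1] using S.smul_mem (μ.real s) h

/-- A closed subalgebra of continuous functions on a closed disc containing `z` and its conjugate is
everything. -/
theorem eq_top_of_id_mem_of_star_mem {r : ℝ} {A : Subalgebra ℂ C(closedBall (0 : ℂ) r, ℂ)}
    (hA : IsClosed (A : Set C(closedBall (0 : ℂ) r, ℂ)))
    (h1 : ContinuousMap.restrict (closedBall (0 : ℂ) r) (.id ℂ) ∈ A)
    (h2 : star (ContinuousMap.restrict (closedBall (0 : ℂ) r) (.id ℂ)) ∈ A) : A = ⊤ := by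
  rw [eq_top_iff]
  intro f _
  have hf : f ∈ StarAlgebra.elemental ℂ (ContinuousMap.restrict (closedBall (0 : ℂ) r) (.id ℂ)) := by
    rw [ContinuousMap.elemental_id_eq_top]; trivial
  have hle : ((StarAlgebra.adjoin ℂ {ContinuousMap.restrict (closedBall (0 : ℂ) r) (.id ℂ)} :
      StarSubalgebra ℂ _) : Set C(closedBall (0 : ℂ) r, ℂ)) ⊆ A := by
    intro g hg
    have hg' : g ∈ (StarAlgebra.adjoin ℂ
      {ContinuousMap.restrict (closedBall (0 : ℂ) r) (.id ℂ)}).toSubalgebra := hg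
    rw [StarAlgebra.adjoin_toSubalgebra] at hg'
    refine Algebra.adjoin_le ?_ hg'
    rw [Set.star_singleton]
    simp [Set.insert_subset_iff, h1, h2]
  exact closure_minimal hle hA hf

theorem integrableOn_inv_norm_ball (ρ : ℝ) :
    IntegrableOn (fun u : ℂ => ‖u‖⁻¹) (ball 0 ρ) := by
  refine (integrableOn_fun_norm_addHaar volume (f := fun y : ℝ => y⁻¹)).2 ?_
  rw [Complex.finrank_real_complex]
  have h : IntegrableOn (fun _ : ℝ => (1 : ℝ)) (Ioo 0 ρ) := by simp
  refine h.congr_fun (fun y hy => ?_) measurableSet_Ioo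
  have : y ≠ 0 := hy.1.ne'
  simp [this]

theorem integrableOn_inv_sub_ball {r : ℝ} {z : ℂ} (hz : z ∈ closedBall (0 : ℂ) r) :
    IntegrableOn (fun b : ℂ => (z - b)⁻¹) (ball 0 r) := by
  have h : Integrable ((ball (0 : ℂ) (2 * r)).indicator fun u : ℂ => u⁻¹) := by
    refine IntegrableOn.integrable_indicator ?_ measurableSet_ball
    refine (integrable_norm_iff (by fun_prop)).1 ?_
    simpa using! integrableOn_inv_norm_ball (2 * r)
  refine ((h.comp_sub_left z).integrableOn (s := ball 0 r)).congr_fun (fun b hb => ?_)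
    measurableSet_ball
  refine indicator_of_mem ?_ _
  simp only [mem_ball, mem_closedBall, dist_zero_right] at *
  linarith [norm_sub_le z b]

theorem circleAverage_inv_sub_of_lt {z : ℂ} {t : ℝ} (ht : 0 < t) (h : t < ‖z‖) :
    circleAverage (fun b => (z - b)⁻¹) 0 t = z⁻¹ := by
  have hd : DifferentiableOn ℂ (fun b => (z - b)⁻¹) (closedBall 0 |t|) := by
    intro b hb
    rw [abs_of_pos ht, mem_closedBall, dist_zero_right] at hb
    have : z - b ≠ 0 := by
      rw [sub_ne_zero]; rintro rfl; linarith
    fun_prop (disch := assumption)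
  simpa using (hd.diffContOnCl_ball subset_rfl).circleAverage

theorem circleAverage_inv_sub_of_gt {z : ℂ} {t : ℝ} (h : ‖z‖ < t) :
    circleAverage (fun b => (z - b)⁻¹) 0 t = 0 := by
  have ht : 0 < t := (norm_nonneg z).trans_lt h
  rw [circleAverage_eq_circleIntegral ht.ne']
  rcases eq_or_ne z 0 with rfl | hz
  · have : (∮ b in C((0 : ℂ), t), (b - 0)⁻¹ • ((0 : ℂ) - b)⁻¹) =
        ∮ b in C((0 : ℂ), t), (-1 : ℂ) • (b - 0) ^ (-2 : ℤ) := by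
      congr 1; ext b
      rw [zpow_neg]
      simp [inv_neg, ← sq]
    rw [this, circleIntegral.integral_smul, circleIntegral.integral_sub_zpow_of_ne (by norm_num)]
    simp
  · have hne : ∀ b ∈ sphere (0 : ℂ) t, b ≠ 0 ∧ z - b ≠ 0 := by
      intro b hb
      rw [mem_sphere, dist_zero_right] at hb
      refine ⟨norm_pos_iff.1 (hb ▸ ht), sub_ne_zero.2 ?_⟩
      rintro rfl; linarith
    have : (∮ b in C((0 : ℂ), t), (b - 0)⁻¹ • (z - b)⁻¹) =
        ∮ b in C((0 : ℂ), t), z⁻¹ • ((b - 0)⁻¹ - (b - z)⁻¹) := by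
      refine circleIntegral.integral_congr ht.le fun b hb => ?_
      obtain ⟨h1, h2⟩ := hne b hb
      have h3 : b - z ≠ 0 := by rw [← neg_sub]; exact neg_ne_zero.2 h2
      simp only [sub_zero, smul_eq_mul]
      field_simp
      ring
    rw [this, circleIntegral.integral_smul, circleIntegral.integral_sub,
      circleIntegral.integral_sub_inv_of_mem_ball, circleIntegral.integral_sub_inv_of_mem_ball]
    · simp
    · simpa using h
    · simpa using ht
    · refine ContinuousOn.circleIntegrable ht.le ?_
      refine ContinuousOn.inv₀ (by fun_prop) fun b hb => ?_
      simpa using (hne b hb).1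
    · refine ContinuousOn.circleIntegrable ht.le ?_
      refine ContinuousOn.inv₀ (by fun_prop) fun b hb => ?_
      rw [← neg_sub]; exact neg_ne_zero.2 (hne b hb).2

/-- Integration over `ℂ` as a radial integral of circle averages. -/
theorem integral_eq_integral_circleAverage {f : ℂ → ℂ} (hf : Integrable f)
    (hfm : Measurable f) :
    ∫ b, f b = ∫ t in Ioi (0 : ℝ), t • (2 * π) • circleAverage f 0 t := by
  rw [← Complex.integral_comp_polarCoord_symm]
  have hint : IntegrableOn (fun p : ℝ × ℝ => p.1 • f (Complex.polarCoord.symm p))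
      (Ioi (0 : ℝ) ×ˢ Ioo (-π) π) := by
    have hm : Measurable fun p : ℝ × ℝ => Complex.polarCoord.symm p := by
      simp only [Complex.polarCoord_symm_apply]
      fun_prop
    refine ⟨(measurable_fst.smul (hfm.comp hm)).aestronglyMeasurable, ?_⟩
    have h2 := hf.2
    rw [hasFiniteIntegral_iff_enorm, ← Complex.lintegral_comp_polarCoord_symm] at h2
    rw [hasFiniteIntegral_iff_enorm]
    refine lt_of_eq_of_lt (setLIntegral_congr_fun (by measurability) fun p hp => ?_) h2
    simp only [enorm_smul, smul_eq_mul]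
    rw [Real.enorm_eq_ofReal (le_of_lt hp.1)]
  have htar : polarCoord.target = Ioi (0 : ℝ) ×ˢ Ioo (-π) π := rfl
  rw [htar, Measure.volume_eq_prod, setIntegral_prod _ hint]
  refine setIntegral_congr_fun measurableSet_Ioi fun t ht => ?_
  simp only
  rw [integral_smul, circleAverage_eq_integral_add (-π), smul_smul (2 * π),
    mul_inv_cancel₀ (by positivity), one_smul,
    intervalIntegral.integral_comp_add_right (fun θ => f (circleMap 0 t θ)),
    intervalIntegral.integral_of_le (by linarith [pi_pos]), integral_Ioc_eq_integral_Ioo]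
  congr 1
  have e1 : 0 + -π = -π := by ring
  have e2 : 2 * π + -π = π := by ring
  rw [e1, e2]
  congr 1
  ext θ
  congr 1
  rw [Complex.polarCoord_symm_apply, circleMap, Complex.exp_mul_I]
  push_cast; ring

/-- The Cauchy transform of a disc: `∫ 1 / (z - b) = π z̄` for `z` in the closed disc. -/
theorem integral_ball_inv_sub {r : ℝ} {z : ℂ} (hz : z ∈ closedBall (0 : ℂ) r) :
    ∫ b in ball (0 : ℂ) r, (z - b)⁻¹ = π * (starRingEnd ℂ) z := by
  rw [← integral_indicator measurableSet_ball, integral_eq_integral_circleAverage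
    ((integrableOn_inv_sub_ball hz).integrable_indicator measurableSet_ball)
    (Measurable.indicator (by fun_prop) measurableSet_ball)]
  have key : ∀ᵐ t : ℝ, t ∈ Ioi (0 : ℝ) →
      t • (2 * π) • circleAverage ((ball (0 : ℂ) r).indicator fun b => (z - b)⁻¹) 0 t =
      (Iio ‖z‖).indicator (fun t : ℝ => (t : ℂ) * (2 * π * z⁻¹)) t := by
    have hne : ∀ᵐ t : ℝ, t ≠ ‖z‖ := by simp [ae_iff]
    filter_upwards [hne] with t htz ht
    rw [mem_closedBall, dist_zero_right] at hz
    rw [mem_Ioi] at ht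
    rcases lt_or_ge t r with htr | htr
    · have : circleAverage ((ball (0 : ℂ) r).indicator fun b => (z - b)⁻¹) 0 t =
          circleAverage (fun b => (z - b)⁻¹) 0 t := by
        refine circleAverage_congr_sphere fun b hb => indicator_of_mem ?_ _
        rw [mem_sphere, dist_zero_right, abs_of_pos ht] at hb
        simpa [hb] using htr
      rw [this]
      rcases lt_or_gt_of_ne htz with h | h
      · rw [circleAverage_inv_sub_of_lt ht h, indicator_of_mem (by exact h)]
        simp
      · rw [circleAverage_inv_sub_of_gt h, indicator_of_notMem (by simpa using h.le)]
        simp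
    · have : circleAverage ((ball (0 : ℂ) r).indicator fun b => (z - b)⁻¹) 0 t =
          circleAverage (fun b => (0 : ℂ)) 0 t := by
        refine circleAverage_congr_sphere fun b hb => indicator_of_notMem ?_ _
        rw [mem_sphere, dist_zero_right, abs_of_pos ht] at hb
        simpa [hb] using htr
      rw [this, circleAverage_const, indicator_of_notMem (by simpa using hz.trans htr)]
      simp
  rw [setIntegral_congr_ae measurableSet_Ioi key, setIntegral_indicator measurableSet_Iio,
    Ioi_inter_Iio, ← integral_Ioc_eq_integral_Ioo,
    ← intervalIntegral.integral_of_le (norm_nonneg z), intervalIntegral.integral_mul_const,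
    intervalIntegral.integral_ofReal, integral_id]
  rcases eq_or_ne z 0 with rfl | h0
  · simp
  · have := Complex.mul_conj' z
    push_cast
    field_simp
    rw [← this]; ring

theorem integrableOn_inv_norm_mul_div (ρ c ε : ℝ) (hc : 0 < c) (hε : 0 < ε) (m : ℕ) (z : ℂ) :
    IntegrableOn (fun u : ℂ => ‖u‖⁻¹ * (ε / (c * ‖z ^ m - (z - u) ^ m‖ ^ 2 + ε))) (ball 0 ρ) := by
  refine (integrableOn_inv_norm_ball ρ).mono' (by fun_prop) (ae_of_all _ fun u => ?_)
  rw [Real.norm_of_nonneg (by positivity)]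
  refine mul_le_of_le_one_right (by positivity) ?_
  rw [div_le_one (by positivity)]
  nlinarith [sq_nonneg ‖z ^ m - (z - u) ^ m‖]

theorem ae_pow_sub_ne {m : ℕ} (hm : m ≠ 0) (z : ℂ) : ∀ᵐ u : ℂ, z ^ m - (z - u) ^ m ≠ 0 := by
  have hfin : {w : ℂ | w ^ m = z ^ m}.Finite := by
    refine (Polynomial.nthRootsFinset m (z ^ m)).finite_toSet.subset fun w hw => ?_
    simpa [Polynomial.mem_nthRootsFinset (Nat.pos_of_ne_zero hm)] using hw
  have h2 : {u : ℂ | ¬ z ^ m - (z - u) ^ m ≠ 0} ⊆ (fun w => z - w) '' {w : ℂ | w ^ m = z ^ m} := by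
    intro u hu
    refine ⟨z - u, ?_, by simp⟩
    simp only [ne_eq, not_not, mem_ofPred_eq, sub_eq_zero] at hu
    exact hu.symm
  exact measure_mono_null h2 ((hfin.image _).measure_zero _)

theorem tendsto_integral_inv_norm_mul_div (ρ c : ℝ) (hc : 0 < c) {m : ℕ} (hm : m ≠ 0) (z : ℂ) :
    Tendsto (fun p : ℝ × ℂ => ∫ u in ball (0 : ℂ) ρ,
      ‖u‖⁻¹ * (p.1 / (c * ‖p.2 ^ m - (p.2 - u) ^ m‖ ^ 2 + p.1))) (𝓝[>] 0 ×ˢ 𝓝 z) (𝓝 0) := by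
  have hpos : ∀ᶠ p : ℝ × ℂ in 𝓝[>] 0 ×ˢ 𝓝 z, 0 < p.1 :=
    tendsto_fst.eventually self_mem_nhdsWithin
  have hle : (𝓝[>] (0 : ℝ)) ×ˢ 𝓝 z ≤ 𝓝 ((0 : ℝ), z) := by
    rw [nhds_prod_eq]; exact prod_mono nhdsWithin_le_nhds le_rfl
  have := tendsto_integral_filter_of_dominated_convergence
    (μ := volume.restrict (ball (0 : ℂ) ρ)) (l := 𝓝[>] (0 : ℝ) ×ˢ 𝓝 z)
    (F := fun (p : ℝ × ℂ) (u : ℂ) =>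
      ‖u‖⁻¹ * (p.1 / (c * ‖p.2 ^ m - (p.2 - u) ^ m‖ ^ 2 + p.1))) (f := fun _ => 0)
    (fun u => ‖u‖⁻¹) (Eventually.of_forall fun p => by fun_prop) ?_
    (integrableOn_inv_norm_ball ρ) ?_
  · simpa using this
  · filter_upwards [hpos] with p hp
    refine ae_of_all _ fun u => ?_
    rw [Real.norm_of_nonneg (by positivity)]
    refine mul_le_of_le_one_right (by positivity) ?_
    rw [div_le_one (by positivity)]
    nlinarith [sq_nonneg ‖p.2 ^ m - (p.2 - u) ^ m‖]
  · filter_upwards [ae_restrict_of_ae (ae_pow_sub_ne hm z)] with u hu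
    have hden : c * ‖z ^ m - (z - u) ^ m‖ ^ 2 + 0 ≠ 0 := by positivity
    have hcont : ContinuousAt (fun p : ℝ × ℂ =>
        ‖u‖⁻¹ * (p.1 / (c * ‖p.2 ^ m - (p.2 - u) ^ m‖ ^ 2 + p.1))) (0, z) := by
      refine ContinuousAt.mul (by fun_prop) (ContinuousAt.div (by fun_prop) (by fun_prop) hden)
    have := hcont.tendsto.mono_left hle
    simpa using this

theorem norm_inv_sub_sub_le {m : ℕ} {z b g : ℂ} {c ε : ℝ} (hc : 0 < c) (hε : 0 < ε)
    (hg : c * ‖z ^ m - b ^ m‖ ^ 2 ≤ ((z ^ m - b ^ m) * g).re) (h0 : z = b → g = 0) :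
    ‖(∑ i ∈ Finset.range m, z ^ i * b ^ (m - 1 - i)) * g * ((z ^ m - b ^ m) * g + ε)⁻¹ -
      (z - b)⁻¹‖ ≤ ‖z - b‖⁻¹ * (ε / (c * ‖z ^ m - b ^ m‖ ^ 2 + ε)) := by
  rcases eq_or_ne z b with rfl | hne
  · simp [h0 rfl]
  have hsum := geom_sum₂_mul z b m
  set Q := ∑ i ∈ Finset.range m, z ^ i * b ^ (m - 1 - i)
  have hzb : z - b ≠ 0 := sub_ne_zero.2 hne
  have hre : c * ‖z ^ m - b ^ m‖ ^ 2 + ε ≤ ‖(z ^ m - b ^ m) * g + ε‖ := by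
    refine le_trans ?_ (re_le_norm _)
    simpa using hg
  have hpos : 0 < c * ‖z ^ m - b ^ m‖ ^ 2 + ε := by positivity
  have hden : (z ^ m - b ^ m) * g + ε ≠ 0 := norm_pos_iff.1 (hpos.trans_le hre)
  have heq : Q * g * ((z ^ m - b ^ m) * g + ε)⁻¹ - (z - b)⁻¹ =
      -((z - b)⁻¹ * (ε / ((z ^ m - b ^ m) * g + ε))) := by
    have hD : (z ^ m - b ^ m) * g + ε = Q * (z - b) * g + ε := by rw [hsum]
    generalize (z ^ m - b ^ m) * g + (ε : ℂ) = D at hden hD ⊢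
    field_simp
    linear_combination -hD
  rw [heq, norm_neg, norm_mul, norm_inv, norm_div, Complex.norm_of_nonneg hε.le]
  gcongr

/-- If `Re ((zᵐ - bᵐ) (F z - F b)) ≥ c |zᵐ - bᵐ|²`, a closed algebra containing `z` and `F` contains the
conjugate of `z`: the Cauchy kernel is approximated by elements
`(∑ zⁱ bᵐ⁻¹⁻ⁱ) (F z - F b) / ((zᵐ - bᵐ) (F z - F b) + ε)` of the algebra, which are then integrated in `b`. -/
theorem star_mem_of_re_mul_sub_ge {r c : ℝ} (hc : 0 < c) {m : ℕ} (hm : m ≠ 0)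
    {A : Subalgebra ℂ C(closedBall (0 : ℂ) r, ℂ)}
    (hA : IsClosed (A : Set C(closedBall (0 : ℂ) r, ℂ)))
    (hZ : ContinuousMap.restrict (closedBall (0 : ℂ) r) (.id ℂ) ∈ A)
    {F : C(closedBall (0 : ℂ) r, ℂ)} (hF : F ∈ A)
    (h : ∀ z b : closedBall (0 : ℂ) r, c * ‖(z : ℂ) ^ m - (b : ℂ) ^ m‖ ^ 2 ≤
      (((z : ℂ) ^ m - (b : ℂ) ^ m) * (F z - F b)).re) :
    star (ContinuousMap.restrict (closedBall (0 : ℂ) r) (.id ℂ)) ∈ A := by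
  classical
  set Z := ContinuousMap.restrict (closedBall (0 : ℂ) r) (.id ℂ)
  have hZa : ∀ x, Z x = x := fun _ => rfl
  let den (ε : ℝ) (b : closedBall (0 : ℂ) r) : C(closedBall (0 : ℂ) r, ℂ) :=
    (Z ^ m - algebraMap ℂ _ ((b : ℂ) ^ m)) * (F - algebraMap ℂ _ (F b)) + algebraMap ℂ _ (ε : ℂ)
  let k (ε : ℝ) (b : closedBall (0 : ℂ) r) : C(closedBall (0 : ℂ) r, ℂ) :=
    (∑ i ∈ Finset.range m, Z ^ i * algebraMap ℂ _ ((b : ℂ) ^ (m - 1 - i))) *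
      (F - algebraMap ℂ _ (F b)) * Ring.inverse (den ε b)
  let k' (ε : ℝ) (b : ℂ) : C(closedBall (0 : ℂ) r, ℂ) :=
    if hb : b ∈ closedBall (0 : ℂ) r then k ε ⟨b, hb⟩ else 0
  have hdenA : ∀ ε b, den ε b ∈ A := fun ε b =>
    A.add_mem (A.mul_mem (A.sub_mem (A.pow_mem hZ _) (A.algebraMap_mem _))
      (A.sub_mem hF (A.algebraMap_mem _))) (A.algebraMap_mem _)
  have hdenre : ∀ ε b x, ε ≤ (den ε b x).re := fun ε b x => by
    have h1 := h x b
    have h2 : den ε b x = ((x : ℂ) ^ m - (b : ℂ) ^ m) * (F x - F b) + ε := by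
      simp [den, hZa]
    rw [h2, add_re, ofReal_re]
    nlinarith [sq_nonneg ‖(x : ℂ) ^ m - (b : ℂ) ^ m‖]
  have hkA : ∀ ε > 0, ∀ b, k ε b ∈ A := fun ε hε b =>
    A.mul_mem (A.mul_mem (A.sum_mem fun i _ => A.mul_mem (A.pow_mem hZ _) (A.algebraMap_mem _))
      (A.sub_mem hF (A.algebraMap_mem _)))
      (inverse_mem_of_re_pos hA (hdenA ε b) hε (hdenre ε b)).2.1
  have hkc : ∀ ε > 0, Continuous (k ε) := fun ε hε => by
    have hden : Continuous (den ε) := by fun_prop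
    have hinv : Continuous fun b => Ring.inverse (den ε b) := by
      rw [continuous_iff_continuousAt]
      intro b
      obtain ⟨u, hu⟩ := (inverse_mem_of_re_pos hA (hdenA ε b) hε (hdenre ε b)).1
      have := NormedRing.inverse_continuousAt u
      rw [hu] at this
      exact this.comp hden.continuousAt
    fun_prop
  have hkx : ∀ ε > 0, ∀ b x, k ε b x =
      (∑ i ∈ Finset.range m, (x : ℂ) ^ i * (b : ℂ) ^ (m - 1 - i)) * (F x - F b) *
        (((x : ℂ) ^ m - (b : ℂ) ^ m) * (F x - F b) + ε)⁻¹ := fun ε hε b x => by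
    simp only [k, ContinuousMap.mul_apply]
    rw [(inverse_mem_of_re_pos hA (hdenA ε b) hε (hdenre ε b)).2.2 x]
    simp [den, hZa]
  have hk'c : ∀ ε > 0, IntegrableOn (k' ε) (ball 0 r) := fun ε hε => by
    refine IntegrableOn.mono_set ?_ ball_subset_closedBall
    refine ContinuousOn.integrableOn_compact (isCompact_closedBall _ _) ?_
    rw [continuousOn_iff_continuous_domRestrict]
    refine (hkc ε hε).congr fun b => ?_
    simp only [Set.domRestrict_apply, k', dif_pos b.2]
  have hIA : ∀ ε > 0, ∫ b in ball (0 : ℂ) r, k' ε b ∈ A := fun ε hε => by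
    refine setIntegral_mem_of_isClosed measurableSet_ball (A.toSubmodule.restrictScalars ℝ) hA
      (fun b hb => ?_) measure_ball_lt_top.ne (hk'c ε hε)
    simp only [k', dif_pos (ball_subset_closedBall hb)]
    exact hkA ε hε _
  have herr : ∀ ε > 0, ∀ z : closedBall (0 : ℂ) r,
      ‖(∫ b in ball (0 : ℂ) r, k' ε b) z - π * (starRingEnd ℂ) (z : ℂ)‖ ≤
        ∫ u in ball (0 : ℂ) (2 * r),
          ‖u‖⁻¹ * (ε / (c * ‖(z : ℂ) ^ m - (z - u) ^ m‖ ^ 2 + ε)) := fun ε hε z => by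
    have hφ := (integrableOn_inv_norm_mul_div (2 * r) c ε hc hε m z).integrable_indicator
      measurableSet_ball
    rw [ContinuousMap.integral_apply (hk'c ε hε), ← integral_ball_inv_sub z.2,
      ← integral_sub (f := fun b => k' ε b z)
        ((ContinuousMap.evalCLM ℝ z).integrable_comp (hk'c ε hε)) (integrableOn_inv_sub_ball z.2)]
    conv_rhs => rw [← integral_indicator measurableSet_ball, ← integral_sub_left_eq_self _ volume (z : ℂ)]
    have hφz := hφ.comp_sub_left (z : ℂ)
    refine le_trans (norm_integral_le_of_norm_le hφz.integrableOn ?_)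
      (setIntegral_le_integral hφz (ae_of_all _ fun b => ?_))
    · refine (ae_restrict_iff' measurableSet_ball).2 (ae_of_all _ fun b hb => ?_)
      have hb' : b ∈ closedBall (0 : ℂ) r := ball_subset_closedBall hb
      have hmem : (z : ℂ) - b ∈ ball (0 : ℂ) (2 * r) := by
        have hz := z.2
        simp only [mem_ball, mem_closedBall, dist_zero_right] at *
        linarith [norm_sub_le (z : ℂ) b]
      rw [indicator_of_mem hmem, sub_sub_cancel]
      simp only [k', dif_pos hb']
      rw [hkx ε hε]
      refine norm_inv_sub_sub_le hc hε (h z ⟨b, hb'⟩) fun hzb => ?_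
      rw [sub_eq_zero]
      exact congrArg F (Subtype.ext hzb)
    · exact indicator_nonneg (fun u _ => by positivity) _
  have hunif : TendstoUniformly (fun (ε : ℝ) (z : closedBall (0 : ℂ) r) =>
      ∫ u in ball (0 : ℂ) (2 * r), ‖u‖⁻¹ * (ε / (c * ‖(z : ℂ) ^ m - (z - u) ^ m‖ ^ 2 + ε)))
      (fun _ => 0) (𝓝[>] 0) := by
    rw [← tendstoLocallyUniformly_iff_tendstoUniformly_of_compactSpace,
      tendstoLocallyUniformly_iff_forall_tendsto]
    intro z
    rw [← Uniform.tendsto_nhds_right]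
    exact (tendsto_integral_inv_norm_mul_div (2 * r) c hc hm (z : ℂ)).comp
      (tendsto_id.prodMap continuous_subtype_val.continuousAt)
  have hπ : ((π : ℂ) • star Z) ∈ A := by
    refine hA.closure_subset (Metric.mem_closure_iff.2 fun η hη => ?_)
    obtain ⟨ε, hε, hε0⟩ := ((Metric.tendstoUniformly_iff.1 hunif η hη).and
      self_mem_nhdsWithin).exists
    refine ⟨_, hIA ε hε0, ?_⟩
    rw [dist_comm, ContinuousMap.dist_lt_iff hη]
    intro z
    rw [dist_eq_norm]
    refine lt_of_le_of_lt (herr ε hε0 z) ?_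
    have := hε z
    rw [dist_zero_left] at this
    exact (le_abs_self _).trans_lt this
  have h3 := A.smul_mem hπ (π : ℂ)⁻¹
  rwa [smul_smul, inv_mul_cancel₀ (by exact_mod_cast pi_ne_zero), one_smul] at h3

theorem re_mul_conj_add_ge {d ρ : ℂ} {α : ℝ} (h : ‖ρ‖ ≤ α * ‖d‖) :
    (1 - α) * ‖d‖ ^ 2 ≤ (d * ((starRingEnd ℂ) d + ρ)).re := by
  have h1 : (d * ((starRingEnd ℂ) d + ρ)).re = ‖d‖ ^ 2 + (d * ρ).re := by
    rw [mul_add, Complex.mul_conj', add_re]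
    norm_cast
  have h2 : -(‖d‖ * ‖ρ‖) ≤ (d * ρ).re := by
    rw [← norm_mul]; exact neg_le_of_abs_le (abs_re_le_norm _)
  rw [h1]
  nlinarith [mul_le_mul_of_nonneg_left h (norm_nonneg d)]

end

/-- Theorem 1.6 (second part, case `m ≥ 2`): uniform approximation,
i.e. `[z, F]_{D̄} = C(D̄)` for `F(z) = z̄^m + R(z)`. -/
theorem wermerII_uniform_approx (r α : ℝ) (hr : 0 < r) (m : ℕ) (hm : 2 ≤ m)
    (hα0 : 0 < α) (hα1 : α < 1)
    (R : ℂ → ℂ)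
    -- `R ∈ C¹(D̄)`, with (continuous) real Fréchet derivative `R'`:
    (R' : ℂ → ℂ →L[ℝ] ℂ)
    (hR' : ∀ z ∈ closedBall (0 : ℂ) r, HasFDerivWithinAt R (R' z) (closedBall 0 r) z)
    (hR'c : ContinuousOn R' (closedBall 0 r))
    (hR : ∀ z ∈ closedBall (0 : ℂ) r, ∀ ζ ∈ closedBall (0 : ℂ) r,
      z ^ m ≠ ζ ^ m → ‖R z - R ζ‖ < α * ‖z ^ m - ζ ^ m‖) :
    ∀ g : ℂ → ℂ, ContinuousOn g (closedBall 0 r) → ∀ ε > 0,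
      ∃ P : MvPolynomial (Fin 2) ℂ, ∀ z ∈ closedBall (0 : ℂ) r,
        ‖g z - MvPolynomial.eval ![z, (starRingEnd ℂ) z ^ m + R z] P‖ < ε := by
  intro g hg ε hε
  have hRc : ContinuousOn R (closedBall 0 r) := fun z hz => (hR' z hz).continuousWithinAt
  let Z := ContinuousMap.restrict (closedBall (0 : ℂ) r) (.id ℂ)
  let F : C(closedBall (0 : ℂ) r, ℂ) :=
    ⟨fun z => (starRingEnd ℂ) (z : ℂ) ^ m + R z,
      ((continuous_conj.comp continuous_subtype_val).pow m).add hRc.domRestrict⟩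
  let A := (Algebra.adjoin ℂ (Set.range ![Z, F])).topologicalClosure
  have hA : IsClosed (A : Set C(closedBall (0 : ℂ) r, ℂ)) :=
    Subalgebra.isClosed_topologicalClosure _
  have hmem : ∀ i, ![Z, F] i ∈ A := fun i =>
    Subalgebra.le_topologicalClosure _ (Algebra.subset_adjoin ⟨i, rfl⟩)
  have htop : A = ⊤ := by
    refine eq_top_of_id_mem_of_star_mem hA (hmem 0)
      (star_mem_of_re_mul_sub_ge (sub_pos.2 hα1) (by lia : m ≠ 0) hA (hmem 0) (hmem 1)
        fun z b => ?_)
    rcases eq_or_ne ((z : ℂ) ^ m) ((b : ℂ) ^ m) with h | h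
    · simp [h]
    · have := re_mul_conj_add_ge (hR z z.2 b b.2 h).le
      refine this.trans_eq ?_
      congr 2
      simp only [F, Matrix.cons_val_one, Matrix.cons_val_fin_one, ContinuousMap.coe_mk, map_sub, map_pow]
      ring
  have hgA : (⟨(closedBall (0 : ℂ) r).domRestrict g, hg.domRestrict⟩ : C(closedBall (0 : ℂ) r, ℂ)) ∈ A :=
    htop ▸ Algebra.mem_top
  obtain ⟨p, hp, hgp⟩ := Metric.mem_closure_iff.1 hgA ε hε
  rw [SetLike.mem_coe, Algebra.adjoin_range_eq_range_aeval] at hp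
  obtain ⟨P, rfl⟩ := hp
  refine ⟨P, fun z hz => ?_⟩
  have h1 := (ContinuousMap.dist_lt_iff hε).1 hgp ⟨z, hz⟩
  rw [dist_eq_norm] at h1
  have h2 : (ContinuousMap.evalAlgHom ℂ ℂ (⟨z, hz⟩ : closedBall (0 : ℂ) r)).comp
      (MvPolynomial.aeval ![Z, F]) = MvPolynomial.aeval ![z, (starRingEnd ℂ) z ^ m + R z] := by
    ext i
    fin_cases i <;> simp [Z, F]
  have h3 := DFunLike.congr_fun h2 P
  rw [MvPolynomial.aeval_eq_eval] at h3
  rwa [← h3]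
end

section
/- Let D̄ be the closed disc in ℂ with centre 0 and radius r > 0, let m be a positive integer, and let R : D̄ → ℂ satisfy |R(z) − R(ζ)| < |z^m − ζ^m| for all z, ζ ∈ D̄ with z^m ≠ ζ^m. Define F(z) := z̄^m + R(z). Then for all z, ζ ∈ D̄, the number (z^m − ζ^m)·(F(z) − F(ζ)) lies in the set {u + iv ∈ ℂ : u ≥ 0, |v| ≤ √8 · r^m · u^{1/2}}. -/
open Complex Metric

/-- If `‖b‖ ≤ ‖a‖ ≤ 2 * ρ`, then `a * (conj a + b)` lies in the wedge of opening `√8 * ρ` and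
exponent `2`. -/
theorem mul_conj_add_mem_wedge {a b : ℂ} {ρ : ℝ} (hba : ‖b‖ ≤ ‖a‖) (ha : ‖a‖ ≤ 2 * ρ) :
    a * ((starRingEnd ℂ) a + b) ∈ wedge (Real.sqrt 8 * ρ) 2 := by
  have hρ : 0 ≤ ρ := by linarith [norm_nonneg a]
  have hab : ‖a * b‖ ≤ ‖a‖ ^ 2 := by
    rw [norm_mul, sq]
    gcongr
  have hs : ‖a‖ ^ 2 ≤ 4 * ρ ^ 2 := by
    nlinarith [pow_le_pow_left₀ (norm_nonneg a) ha 2]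
  have hsum : a * ((starRingEnd ℂ) a + b) = ((‖a‖ ^ 2 : ℝ) : ℂ) + a * b := by
    rw [mul_add, mul_conj, normSq_eq_norm_sq]
  have hsq : (a * b).re ^ 2 + (a * b).im ^ 2 ≤ (‖a‖ ^ 2) ^ 2 := by
    have h := pow_le_pow_left₀ (norm_nonneg (a * b)) hab 2
    rwa [← normSq_eq_norm_sq, normSq_apply, ← sq, ← sq] at h
  have hre := abs_le.mp ((abs_re_le_norm (a * b)).trans hab)
  rw [hsum]
  generalize a * b = w at hre hsq ⊢
  generalize ‖a‖ ^ 2 = s at hre hsq hs ⊢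
  simp only [wedge, Set.mem_ofPred_eq, add_re, add_im, ofReal_re, ofReal_im, zero_add,
    ← Real.sqrt_eq_rpow]
  refine ⟨by linarith, abs_le_of_sq_le_sq ?_ (by positivity)⟩
  rw [mul_pow, mul_pow, Real.sq_sqrt (by norm_num), Real.sq_sqrt (by linarith)]
  nlinarith [mul_nonneg (by linarith : 0 ≤ s + w.re) (by linarith : 0 ≤ 8 * ρ ^ 2 - (s - w.re))]

/-- For `F(z) = z̄^m + R(z)`, the quantity `(z^m − ζ^m)(F(z) − F(ζ))` lies in the
wedge `{u + iv : u ≥ 0, |v| ≤ √8 r^m u^{1/2}}`. -/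
theorem wermerII_wedge (r : ℝ) (hr : 0 < r) (m : ℕ) (hm : 0 < m)
    (R : ℂ → ℂ)
    (hR : ∀ z ∈ closedBall (0 : ℂ) r, ∀ ζ ∈ closedBall (0 : ℂ) r,
      z ^ m ≠ ζ ^ m → ‖R z - R ζ‖ < ‖z ^ m - ζ ^ m‖) :
    ∀ z ∈ closedBall (0 : ℂ) r, ∀ ζ ∈ closedBall (0 : ℂ) r,
      (z ^ m - ζ ^ m) *
          (((starRingEnd ℂ) z ^ m + R z) - ((starRingEnd ℂ) ζ ^ m + R ζ)) ∈
        wedge (Real.sqrt 8 * r ^ m) 2 := by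
  intro z hz ζ hζ
  have hpow : ∀ x ∈ closedBall (0 : ℂ) r, ‖x ^ m‖ ≤ r ^ m := fun x hx => by
    rw [norm_pow]
    exact pow_le_pow_left₀ (norm_nonneg x) (mem_closedBall_zero_iff.mp hx) m
  by_cases h : z ^ m = ζ ^ m
  · simp [wedge, h]
  · have hdiff : ‖z ^ m - ζ ^ m‖ ≤ 2 * r ^ m := by
      linarith [norm_sub_le (z ^ m) (ζ ^ m), hpow z hz, hpow ζ hζ]
    convert mul_conj_add_mem_wedge (hR z hz ζ hζ h).le hdiff using 2
    simp only [map_sub, map_pow]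
    ring
end

section
/- Let D̄ be the closed disc in ℂ with centre 0 and radius r > 0, let m be a positive integer, and let R : D̄ → ℂ satisfy |R(z) − R(ζ)| < |z^m − ζ^m| for all z, ζ ∈ D̄ with z^m ≠ ζ^m. Define F(z) := z̄^m + R(z). If λ > 1 satisfies |(z^m − ζ^m)·(F(z) − F(ζ))| < λ for all z, ζ ∈ D̄, then |F(z) − F(ζ)|⁴ ≤ 4λ(8 r^{2m} λ + 1) · Re[(z^m − ζ^m)·(F(z) − F(ζ))] for all z, ζ ∈ D̄. -/
open Complex Metric

/-- A function on a closed ball whose increments are bounded by those of `z ^ m` off the fibres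
of `z ^ m` is constant on these fibres. -/
theorem eq_of_pow_eq_of_norm_sub_lt {r : ℝ} {m : ℕ} (hm : 0 < m) {R : ℂ → ℂ}
    (hR : ∀ z ∈ closedBall (0 : ℂ) r, ∀ ζ ∈ closedBall (0 : ℂ) r,
      z ^ m ≠ ζ ^ m → ‖R z - R ζ‖ < ‖z ^ m - ζ ^ m‖)
    {z ζ : ℂ} (hz : z ∈ closedBall (0 : ℂ) r) (hζ : ζ ∈ closedBall (0 : ℂ) r)
    (h : z ^ m = ζ ^ m) : R z = R ζ := by
  rcases eq_or_ne z 0 with rfl | hz0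
  · rw [zero_pow hm.ne', eq_comm, pow_eq_zero_iff hm.ne'] at h
    rw [h]
  have key : ∀ t ∈ Set.Ioo (0 : ℝ) 1,
      ‖R z - R ζ‖ ≤ 2 * ‖z ^ m - ((t : ℂ) * z) ^ m‖ := by
    rintro t ⟨ht0, ht1⟩
    have hw : (t : ℂ) * z ∈ closedBall (0 : ℂ) r := by
      rw [mem_closedBall_zero_iff] at hz ⊢
      rw [norm_mul, Complex.norm_real, Real.norm_of_nonneg ht0.le]
      nlinarith [norm_nonneg z]
    have hne : z ^ m ≠ ((t : ℂ) * z) ^ m := by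
      intro he
      have h1 : (t : ℂ) ^ m = 1 := by
        rw [mul_pow] at he
        exact (mul_eq_right₀ (pow_ne_zero m hz0)).mp he.symm
      have h2 : t ^ m = 1 := by exact_mod_cast h1
      exact (pow_lt_one₀ ht0.le ht1 hm.ne').ne h2
    have h1 := hR z hz _ hw hne
    have h2 := hR ζ hζ _ hw (h ▸ hne)
    rw [← h] at h2
    have h3 := norm_sub_le (R z - R (t * z)) (R ζ - R (t * z))
    rw [sub_sub_sub_cancel_right] at h3
    linarith
  have hcont : Continuous fun t : ℝ => 2 * ‖z ^ m - ((t : ℂ) * z) ^ m‖ := by fun_prop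
  have hlim := (hcont.tendsto 1).mono_left (nhdsWithin_le_nhds (s := Set.Iio 1))
  have hle := ge_of_tendsto hlim
    (Filter.mem_of_superset (Ioo_mem_nhdsLT zero_lt_one) key)
  rw [← sub_eq_zero, ← norm_le_zero_iff]
  simpa using hle

/-- If `‖b‖ ≤ ‖a‖` then `‖conj a + b‖² ≤ 2 Re (a (conj a + b))`. -/
theorem norm_conj_add_sq_le {a b : ℂ} (h : ‖b‖ ≤ ‖a‖) :
    ‖(starRingEnd ℂ) a + b‖ ^ 2 ≤ 2 * (a * ((starRingEnd ℂ) a + b)).re := by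
  have h2 : ‖b‖ ^ 2 ≤ ‖a‖ ^ 2 := by gcongr
  rw [Complex.sq_norm, Complex.sq_norm, normSq_apply, normSq_apply] at h2
  rw [Complex.sq_norm, normSq_apply]
  simp only [add_re, add_im, mul_re, conj_re, conj_im]
  nlinarith

/-- The inequality (5.3): for `F(z) = z̄^m + R(z)`,
`|F(z) − F(ζ)|⁴ ≤ 4λ(8 r^{2m} λ + 1) Re[(z^m − ζ^m)(F(z) − F(ζ))]`. -/
theorem wermerII_quartic_estimate (r lam : ℝ) (hr : 0 < r) (m : ℕ) (hm : 0 < m)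
    (R : ℂ → ℂ)
    (hR : ∀ z ∈ closedBall (0 : ℂ) r, ∀ ζ ∈ closedBall (0 : ℂ) r,
      z ^ m ≠ ζ ^ m → ‖R z - R ζ‖ < ‖z ^ m - ζ ^ m‖)
    (hlam : 1 < lam)
    (hbd : ∀ z ∈ closedBall (0 : ℂ) r, ∀ ζ ∈ closedBall (0 : ℂ) r,
      ‖(z ^ m - ζ ^ m) *
          (((starRingEnd ℂ) z ^ m + R z) - ((starRingEnd ℂ) ζ ^ m + R ζ))‖ < lam) :
    ∀ z ∈ closedBall (0 : ℂ) r, ∀ ζ ∈ closedBall (0 : ℂ) r,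
      ‖((starRingEnd ℂ) z ^ m + R z) - ((starRingEnd ℂ) ζ ^ m + R ζ)‖ ^ 4 ≤
        4 * lam * (8 * r ^ (2 * m) * lam + 1) *
          ((z ^ m - ζ ^ m) *
              (((starRingEnd ℂ) z ^ m + R z) - ((starRingEnd ℂ) ζ ^ m + R ζ))).re := by
  intro z hz ζ hζ
  have hle : ‖R z - R ζ‖ ≤ ‖z ^ m - ζ ^ m‖ := by
    by_cases h : z ^ m = ζ ^ m
    · rw [eq_of_pow_eq_of_norm_sub_lt hm hR hz hζ h, sub_self, norm_zero]
      exact norm_nonneg _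
    · exact (hR z hz ζ hζ h).le
  have hD : ((starRingEnd ℂ) z ^ m + R z) - ((starRingEnd ℂ) ζ ^ m + R ζ) =
      (starRingEnd ℂ) (z ^ m - ζ ^ m) + (R z - R ζ) := by
    simp only [map_sub, map_pow]
    ring
  have hX := hbd z hz ζ hζ
  rw [hD] at hX ⊢
  have hsq := norm_conj_add_sq_le hle
  have hXlam := (re_le_norm _).trans hX.le
  set X := ((z ^ m - ζ ^ m) * ((starRingEnd ℂ) (z ^ m - ζ ^ m) + (R z - R ζ))).re
  set N := ‖(starRingEnd ℂ) (z ^ m - ζ ^ m) + (R z - R ζ)‖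
  have hX0 : 0 ≤ X := by linarith [sq_nonneg N]
  have hlam0 : 0 < lam := by linarith
  calc N ^ 4 = (N ^ 2) ^ 2 := by ring
    _ ≤ (2 * X) ^ 2 := by gcongr
    _ = 4 * X * X := by ring
    _ ≤ 4 * lam * X := by gcongr
    _ = 4 * lam * 1 * X := by ring
    _ ≤ 4 * lam * (8 * r ^ (2 * m) * lam + 1) * X := by
      gcongr
      exact le_add_of_nonneg_left (by positivity)
end

section
/- Let D̄ be a closed disc in ℂ with centre 0, let m ≥ 2 be an integer, let α ∈ (0, 1), and let R ∈ C¹(D̄) (in the real sense) satisfy |R(z) − R(ζ)| < α|z^m − ζ^m| for all z, ζ ∈ D̄ with z^m ≠ ζ^m. Define F(z) := z̄^m + R(z). Then for every z ∈ D̄ with z ≠ 0 one has |∂_z̄F(z)| ≥ (m(1 − α)/2)|z|^{m−1} > 0. Consequently, {z ∈ D̄ : ∂_z̄F(z) = 0} = {0}. -/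
open Complex Metric

open Filter Topology in
/-- A pointwise bound between increments of two maps passes to their derivatives. -/
theorem HasFDerivAt.norm_apply_le_of_norm_sub_le {E F G : Type*}
    [NormedAddCommGroup E] [NormedSpace ℝ E] [NormedAddCommGroup F] [NormedSpace ℝ F]
    [NormedAddCommGroup G] [NormedSpace ℝ G] {f : E → F} {g : E → G} {f' : E →L[ℝ] F}
    {g' : E →L[ℝ] G} {x : E} {c : ℝ} (hf : HasFDerivAt f f' x) (hg : HasFDerivAt g g' x)
    (h : ∀ᶠ y in 𝓝 x, ‖f y - f x‖ ≤ c * ‖g y - g x‖) (v : E) : ‖f' v‖ ≤ c * ‖g' v‖ := by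
  have hf₁ := (hf.hasLineDerivAt v).tendsto_slope_zero.norm
  have hg₁ := (hg.hasLineDerivAt v).tendsto_slope_zero.norm.const_mul c
  refine le_of_tendsto_of_tendsto hf₁ hg₁ ?_
  have hline : Tendsto (fun t : ℝ => x + t • v) (𝓝[≠] 0) (𝓝 x) := by
    have : ContinuousAt (fun t : ℝ => x + t • v) 0 := by fun_prop
    simpa using this.tendsto.mono_left nhdsWithin_le_nhds
  filter_upwards [hline.eventually h] with t ht
  simp only [norm_smul]
  nlinarith [mul_le_mul_of_nonneg_left ht (norm_nonneg t⁻¹)]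

open Filter Topology in
/-- A point is locally the only solution `w` of `w ^ m = z ^ m`. -/
theorem Complex.eventually_pow_eq_pow_imp_eq {m : ℕ} (hm : m ≠ 0) (z : ℂ) :
    ∀ᶠ w in 𝓝 z, w ^ m = z ^ m → w = z := by
  rcases eq_or_ne z 0 with rfl | hz
  · filter_upwards with w hw
    rw [zero_pow hm] at hw
    exact eq_zero_of_pow_eq_zero hw
  · have hd : (m : ℂ) * z ^ (m - 1) ≠ 0 :=
      mul_ne_zero (Nat.cast_ne_zero.mpr hm) (pow_ne_zero _ hz)
    have := eventually_nhdsWithin_iff.mp ((hasDerivAt_pow m z).eventually_ne (c := z ^ m) hd)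
    filter_upwards [this] with w hw hwm
    by_contra hne
    exact hw hne hwm

/-- The Wirtinger derivative is bounded by any bound for the two partial derivatives. -/
theorem norm_dbar_le {F' : ℂ → ℂ →L[ℝ] ℂ} {z : ℂ} {B : ℝ} (h₁ : ‖F' z 1‖ ≤ B)
    (h₂ : ‖F' z Complex.I‖ ≤ B) : ‖dbar F' z‖ ≤ B := by
  have h := norm_add_le (F' z 1) (Complex.I * F' z Complex.I)
  rw [norm_mul, Complex.norm_I, one_mul] at h
  rw [dbar, norm_mul]
  norm_num
  linarith

/-- If increments of `R` are controlled by increments of `z ^ m` on a disc, then so is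
`∂R/∂z̄`, up to the boundary. -/
theorem norm_dbar_le_of_norm_sub_le_pow {r α : ℝ} (hr : 0 < r) {m : ℕ} (hm : m ≠ 0)
    {R : ℂ → ℂ} {R' : ℂ → ℂ →L[ℝ] ℂ}
    (hR' : ∀ z ∈ closedBall (0 : ℂ) r, HasFDerivWithinAt R (R' z) (closedBall 0 r) z)
    (hR'c : ContinuousOn R' (closedBall 0 r))
    (hR : ∀ z ∈ closedBall (0 : ℂ) r, ∀ ζ ∈ closedBall (0 : ℂ) r,
      z ^ m ≠ ζ ^ m → ‖R z - R ζ‖ < α * ‖z ^ m - ζ ^ m‖)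
    {z : ℂ} (hz : z ∈ closedBall (0 : ℂ) r) :
    ‖dbar R' z‖ ≤ α * (m * ‖z‖ ^ (m - 1)) := by
  have hinner : ∀ w ∈ ball (0 : ℂ) r, ‖dbar R' w‖ ≤ α * (m * ‖w‖ ^ (m - 1)) := by
    intro w hw
    have hwc := ball_subset_closedBall hw
    have hRw : HasFDerivAt R (R' w) w :=
      (hR' w hwc).hasFDerivAt (closedBall_mem_nhds_of_mem hw)
    have hpow : HasFDerivAt (fun u : ℂ => u ^ m) _ w :=
      (hasDerivAt_pow m w).hasFDerivAt.restrictScalars ℝ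
    have key := hRw.norm_apply_le_of_norm_sub_le (c := α) hpow (by
      filter_upwards [Complex.eventually_pow_eq_pow_imp_eq hm w,
        closedBall_mem_nhds_of_mem hw] with u hu huc
      by_cases h : u ^ m = w ^ m
      · simp [hu h]
      · exact (hR u huc w hwc h).le)
    exact norm_dbar_le (by simpa using key 1) (by simpa using key Complex.I)
  rw [← closure_ball (0 : ℂ) hr.ne'] at hz hR'c
  refine le_on_closure hinner ?_ (by fun_prop) hz
  unfold dbar
  fun_prop

/-- `∂(z̄ ^ m + R)/∂z̄ = m z̄ ^ (m - 1) + ∂R/∂z̄`. -/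
theorem dbar_conj_pow_add {s : Set ℂ} {m : ℕ} {R : ℂ → ℂ} {R' F' : ℂ → ℂ →L[ℝ] ℂ} {z : ℂ}
    (hs : UniqueDiffWithinAt ℝ s z) (hR' : HasFDerivWithinAt R (R' z) s z)
    (hF' : HasFDerivWithinAt (fun w => (starRingEnd ℂ) w ^ m + R w) (F' z) s z) :
    dbar F' z = m * (starRingEnd ℂ) z ^ (m - 1) + dbar R' z := by
  have hconj : HasFDerivWithinAt (fun w => (starRingEnd ℂ) w)
      (Complex.conjCLE : ℂ →L[ℝ] ℂ) s z :=
    Complex.conjCLE.hasFDerivAt.hasFDerivWithinAt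
  have heq := hs.eq hF' ((hconj.pow m).add hR')
  simp only [dbar, heq]
  simp
  linear_combination (-(m * (starRingEnd ℂ) z ^ (m - 1)) / 2) * Complex.I_sq

/-- For `F(z) = z̄^m + R(z)` with `m ≥ 2` and `|R(z) − R(ζ)| < α|z^m − ζ^m|`:
`|∂F/∂z̄(z)| ≥ (m(1 − α)/2)|z|^{m−1} > 0` for `z ≠ 0`, so the zero set of
`∂F/∂z̄` on `D̄` is `{0}`. -/
theorem wermerII_dbar_zero_set (r α : ℝ) (hr : 0 < r) (m : ℕ) (hm : 2 ≤ m)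
    (hα0 : 0 < α) (hα1 : α < 1)
    (R : ℂ → ℂ)
    -- `R ∈ C¹(D̄)`, with (continuous) real Fréchet derivative `R'`:
    (R' : ℂ → ℂ →L[ℝ] ℂ)
    (hR' : ∀ z ∈ closedBall (0 : ℂ) r, HasFDerivWithinAt R (R' z) (closedBall 0 r) z)
    (hR'c : ContinuousOn R' (closedBall 0 r))
    (hR : ∀ z ∈ closedBall (0 : ℂ) r, ∀ ζ ∈ closedBall (0 : ℂ) r,
      z ^ m ≠ ζ ^ m → ‖R z - R ζ‖ < α * ‖z ^ m - ζ ^ m‖)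
    -- `F'` is the real Fréchet derivative of `F = z̄^m + R` on `D̄`:
    (F' : ℂ → ℂ →L[ℝ] ℂ)
    (hF' : ∀ z ∈ closedBall (0 : ℂ) r,
      HasFDerivWithinAt (fun w => (starRingEnd ℂ) w ^ m + R w) (F' z)
        (closedBall 0 r) z) :
    (∀ z ∈ closedBall (0 : ℂ) r, z ≠ 0 →
      (m : ℝ) * (1 - α) / 2 * ‖z‖ ^ (m - 1) ≤ ‖dbar F' z‖ ∧
      0 < (m : ℝ) * (1 - α) / 2 * ‖z‖ ^ (m - 1)) ∧
    {z ∈ closedBall (0 : ℂ) r | dbar F' z = 0} = {0} := by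
  have hbound := fun z (hz : z ∈ closedBall (0 : ℂ) r) =>
    norm_dbar_le_of_norm_sub_le_pow hr (by lia) hR' hR'c hR hz
  have hsplit := fun z (hz : z ∈ closedBall (0 : ℂ) r) =>
    dbar_conj_pow_add (uniqueDiffWithinAt_convex (convex_closedBall 0 r)
      (by simp [interior_closedBall (0 : ℂ) hr.ne', hr]) (subset_closure hz))
      (hR' z hz) (hF' z hz)
  have hpos : ∀ z : ℂ, z ≠ 0 → 0 < (m : ℝ) * (1 - α) / 2 * ‖z‖ ^ (m - 1) := by
    intro z hz
    have h₁ : 0 < 1 - α := by linarith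
    have h₂ : (0 : ℝ) < m := by exact_mod_cast (by lia : 0 < m)
    have h₃ := norm_pos_iff.mpr hz
    positivity
  have hlower : ∀ z ∈ closedBall (0 : ℂ) r, z ≠ 0 →
      (m : ℝ) * (1 - α) / 2 * ‖z‖ ^ (m - 1) ≤ ‖dbar F' z‖ := by
    intro z hz hz0
    have h₁ := norm_sub_le (dbar F' z) (dbar R' z)
    have h₂ : ‖dbar F' z - dbar R' z‖ = m * ‖z‖ ^ (m - 1) := by
      rw [hsplit z hz, add_sub_cancel_right]
      simp
    have h₃ := hbound z hz
    have h₄ := hpos z hz0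
    linarith
  have hzero : (0 : ℂ) ∈ closedBall (0 : ℂ) r := mem_closedBall_self hr.le
  refine ⟨fun z hz hz0 => ⟨hlower z hz hz0, hpos z hz0⟩, ?_⟩
  ext z
  simp only [Set.mem_ofPred_eq, Set.mem_singleton_iff]
  constructor
  · rintro ⟨hz, hdz⟩
    by_contra hz0
    have h := (hpos z hz0).trans_le (hlower z hz hz0)
    simp [hdz] at h
  · rintro rfl
    have hm1 : m - 1 ≠ 0 := by lia
    have h : dbar R' 0 = 0 := by simpa [hm1] using hbound 0 hzero
    exact ⟨hzero, by simp [hsplit 0 hzero, h, hm1]⟩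
end

section
/- Under the hypothesis of the main Hölder theorem — D̄ a closed disc in ℂ with centre 0, F ∈ C^α(D̄) with 0 < α < 1, E ⊂ D̄ nowhere dense, A ∈ 𝒪(D̄) nowhere vanishing, M, K > 0, ν ≥ 1, and for each ζ ∈ D̄ \ E functions G_ζ ∈ 𝒪_ζ(D̄) with |G_ζ(z)| ≤ M|z − ζ| on D̄ and constants C_ζ of modulus 1 with C_ζ·(z − ζ)·(A(z)F(z) − A(ζ)F(ζ) + G_ζ(z)) ∈ W(K, ν) for all z ∈ D̄ — the following holds. Set p := ν(1 + 1/α). Then there exists a constant B ≥ 1, independent of ζ, such that |A(z)F(z) − A(ζ)F(ζ) + G_ζ(z)|^p ≤ B · Re[C_ζ·(z − ζ)·(A(z)F(z) − A(ζ)F(ζ) + G_ζ(z))] for all z ∈ D̄ and all ζ ∈ D̄ \ E. -/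
open Complex Metric

/-- The norm of a point of the wedge, as long as it stays bounded, is controlled by a power of its
real part. -/
lemma norm_le_of_mem_wedge {K ν R : ℝ} {w : ℂ} (hν : 1 ≤ ν) (hw : w ∈ wedge K ν) (hR : ‖w‖ ≤ R) :
    ‖w‖ ≤ (R ^ (1 - 1 / ν) + K) * w.re ^ (1 / ν) := by
  obtain ⟨h0, h1⟩ := hw
  have hν0 : 0 < ν := by linarith
  have hexp : 0 ≤ 1 - 1 / ν := by
    rw [sub_nonneg, div_le_one hν0]
    exact hν
  have hre : w.re ≤ R ^ (1 - 1 / ν) * w.re ^ (1 / ν) := by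
    have hsplit : w.re = w.re ^ (1 - 1 / ν) * w.re ^ (1 / ν) := by
      rw [← Real.rpow_add' h0 (by simp), sub_add_cancel, Real.rpow_one]
    have hle : w.re ≤ R := (Complex.re_le_norm w).trans hR
    calc w.re = w.re ^ (1 - 1 / ν) * w.re ^ (1 / ν) := hsplit
      _ ≤ R ^ (1 - 1 / ν) * w.re ^ (1 / ν) := by gcongr
  have hnorm := Complex.norm_le_abs_re_add_abs_im w
  rw [abs_of_nonneg h0] at hnorm
  linarith

/-- If `h` is bounded by a Hölder modulus in `t` and `w`, of norm `t * ‖h‖`, is a bounded point of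
the wedge, then a power of `‖h‖` is controlled by the real part of `w`. -/
lemma norm_rpow_le_of_mem_wedge {K ν R L α t : ℝ} {h w : ℂ} (hα : 0 < α) (hL : 0 ≤ L)
    (hK : 0 ≤ K) (hν : 1 ≤ ν) (ht : 0 ≤ t) (hw : w ∈ wedge K ν) (hR : ‖w‖ ≤ R)
    (hwt : ‖w‖ = t * ‖h‖) (hh : ‖h‖ ≤ L * t ^ α) :
    ‖h‖ ^ (ν * (1 + 1 / α)) ≤ (L ^ (1 / α) * (R ^ (1 - 1 / ν) + K)) ^ ν * w.re := by
  have hν0 : 0 < ν := by linarith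
  have hre : 0 ≤ w.re := hw.1
  have hR0 : 0 ≤ R := (norm_nonneg w).trans hR
  have hroot : ‖h‖ ^ (1 / α) ≤ L ^ (1 / α) * t := by
    calc ‖h‖ ^ (1 / α) ≤ (L * t ^ α) ^ (1 / α) := by gcongr
      _ = L ^ (1 / α) * t := by
        rw [Real.mul_rpow hL (by positivity), ← Real.rpow_mul ht, mul_one_div_cancel hα.ne',
          Real.rpow_one]
  have hpow : ‖h‖ ^ (1 + 1 / α) ≤
      L ^ (1 / α) * (R ^ (1 - 1 / ν) + K) * w.re ^ (1 / ν) := by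
    calc ‖h‖ ^ (1 + 1 / α) = ‖h‖ * ‖h‖ ^ (1 / α) := by
          rw [Real.rpow_add' (norm_nonneg h) (by positivity), Real.rpow_one]
      _ ≤ ‖h‖ * (L ^ (1 / α) * t) := by gcongr
      _ = L ^ (1 / α) * ‖w‖ := by rw [hwt]; ring
      _ ≤ L ^ (1 / α) * ((R ^ (1 - 1 / ν) + K) * w.re ^ (1 / ν)) := by
          gcongr
          exact norm_le_of_mem_wedge hν hw hR
      _ = _ := by ring
  calc ‖h‖ ^ (ν * (1 + 1 / α)) = (‖h‖ ^ (1 + 1 / α)) ^ ν := by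
        rw [← Real.rpow_mul (norm_nonneg h), mul_comm]
    _ ≤ (L ^ (1 / α) * (R ^ (1 - 1 / ν) + K) * w.re ^ (1 / ν)) ^ ν := by gcongr
    _ = (L ^ (1 / α) * (R ^ (1 - 1 / ν) + K)) ^ ν * w.re := by
        rw [Real.mul_rpow (by positivity) (by positivity), ← Real.rpow_mul hre,
          one_div_mul_cancel hν0.ne', Real.rpow_one]

/-- On the disc, distances are bounded by a multiple of their `α`-th power. -/
lemma norm_sub_le_mul_rpow {r α : ℝ} (hα1 : α < 1) {z w : ℂ}
    (hz : z ∈ closedBall (0 : ℂ) r) (hw : w ∈ closedBall (0 : ℂ) r) :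
    ‖z - w‖ ≤ (2 * r) ^ (1 - α) * ‖z - w‖ ^ α := by
  have hle : ‖z - w‖ ≤ 2 * r := by
    have := norm_sub_le z w
    rw [mem_closedBall_zero_iff] at hz hw
    linarith
  calc ‖z - w‖ = ‖z - w‖ ^ (1 - α) * ‖z - w‖ ^ α := by
        rw [← Real.rpow_add' (norm_nonneg _) (by simp), sub_add_cancel, Real.rpow_one]
    _ ≤ _ := by
        have : 0 ≤ 1 - α := by linarith
        gcongr

lemma HoloNear.exists_lipschitz {A : ℂ → ℂ} {S : Set ℂ} (hA : HoloNear A S) (hS : IsCompact S)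
    (hconv : Convex ℝ S) :
    ∃ c : ℝ, 0 ≤ c ∧ ∀ z ∈ S, ∀ w ∈ S, ‖A z - A w‖ ≤ c * ‖z - w‖ := by
  obtain ⟨U, hU, hSU, hd⟩ := hA
  obtain ⟨c, hc⟩ := hS.exists_bound_of_continuousOn ((hd.deriv hU).continuousOn.mono hSU)
  refine ⟨max c 0, le_max_right _ _, fun z hz w hw => ?_⟩
  exact hconv.norm_image_sub_le_of_norm_deriv_le
    (fun x hx => hd.differentiableAt (hU.mem_nhds (hSU hx)))
    (fun x hx => (hc x hx).trans (le_max_left _ _)) hw hz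

lemma HoloNear.holderOn_closedBall {A : ℂ → ℂ} {r α : ℝ} (hr : 0 ≤ r) (hα1 : α < 1)
    (hA : HoloNear A (closedBall 0 r)) : HolderOn A α (closedBall 0 r) := by
  obtain ⟨c, hc, h⟩ := hA.exists_lipschitz (isCompact_closedBall 0 r) (convex_closedBall 0 r)
  refine ⟨c * (2 * r) ^ (1 - α), by positivity, fun z hz w hw => (h z hz w hw).trans ?_⟩
  rw [mul_assoc]
  gcongr
  exact norm_sub_le_mul_rpow hα1 hz hw

lemma HolderOn.exists_bound_closedBall {F : ℂ → ℂ} {r α : ℝ} (hr : 0 ≤ r) (hα : 0 ≤ α)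
    (hF : HolderOn F α (closedBall 0 r)) :
    ∃ b : ℝ, 0 ≤ b ∧ ∀ z ∈ closedBall (0 : ℂ) r, ‖F z‖ ≤ b := by
  obtain ⟨c, hc, h⟩ := hF
  refine ⟨‖F 0‖ + c * r ^ α, by positivity, fun z hz => ?_⟩
  have hz0 := h z hz 0 (mem_closedBall_self hr)
  rw [sub_zero] at hz0
  have hpow : c * ‖z‖ ^ α ≤ c * r ^ α := by
    rw [mem_closedBall_zero_iff] at hz
    gcongr
  have := norm_le_norm_add_norm_sub' (F z) (F 0)
  linarith

lemma HolderOn.mul_closedBall {A F : ℂ → ℂ} {r α : ℝ} (hr : 0 ≤ r) (hα : 0 ≤ α)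
    (hA : HolderOn A α (closedBall 0 r)) (hF : HolderOn F α (closedBall 0 r)) :
    HolderOn (fun z => A z * F z) α (closedBall 0 r) := by
  obtain ⟨a, ha, hAb⟩ := hA.exists_bound_closedBall hr hα
  obtain ⟨f, hf, hFb⟩ := hF.exists_bound_closedBall hr hα
  obtain ⟨c, hc, hAc⟩ := hA
  obtain ⟨d, hd, hFd⟩ := hF
  refine ⟨a * d + c * f, by positivity, fun z hz w hw => ?_⟩
  calc ‖A z * F z - A w * F w‖ = ‖A z * (F z - F w) + (A z - A w) * F w‖ := by ring_nf
    _ ≤ ‖A z‖ * ‖F z - F w‖ + ‖A z - A w‖ * ‖F w‖ := by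
        simpa only [norm_mul] using norm_add_le (A z * (F z - F w)) ((A z - A w) * F w)
    _ ≤ a * (d * ‖z - w‖ ^ α) + c * ‖z - w‖ ^ α * f := by
        gcongr
        exacts [hAb z hz, hFd z hz w hw, hAc z hz w hw, hFb w hw]
    _ = (a * d + c * f) * ‖z - w‖ ^ α := by ring

/-- Under the hypotheses of Theorem 1.1, with `p := ν(1 + 1/α)`, there is a
uniform constant `B ≥ 1` with
`|A·F(z) − A·F(ζ) + G_ζ(z)|^p ≤ B Re[C_ζ (z − ζ)(A·F(z) − A·F(ζ) + G_ζ(z))]`. -/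
theorem holder_uniform_pinch_estimate (r α M K ν : ℝ) (hr : 0 < r)
    (hα0 : 0 < α) (hα1 : α < 1)
    (F A : ℂ → ℂ) (E : Set ℂ) (G : ℂ → ℂ → ℂ) (C : ℂ → ℂ)
    (hF : HolderOn F α (closedBall 0 r))
    (hE : E ⊆ closedBall 0 r) (hEnd : IsNowhereDense E)
    (hA : HoloNear A (closedBall 0 r))
    (hA0 : ∀ z ∈ closedBall (0 : ℂ) r, A z ≠ 0)
    (hM : 0 < M) (hK : 0 < K) (hν : 1 ≤ ν)
    (hG : ∀ ζ ∈ closedBall (0 : ℂ) r \ E,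
      HoloNear (G ζ) (closedBall 0 r) ∧ G ζ ζ = 0 ∧
        ∀ z ∈ closedBall (0 : ℂ) r, ‖G ζ z‖ ≤ M * ‖z - ζ‖)
    (hC : ∀ ζ ∈ closedBall (0 : ℂ) r \ E,
      ‖C ζ‖ = 1 ∧
        ∀ z ∈ closedBall (0 : ℂ) r,
          C ζ * (z - ζ) * (A z * F z - A ζ * F ζ + G ζ z) ∈ wedge K ν) :
    ∃ B : ℝ, 1 ≤ B ∧
      ∀ ζ ∈ closedBall (0 : ℂ) r \ E, ∀ z ∈ closedBall (0 : ℂ) r,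
        ‖A z * F z - A ζ * F ζ + G ζ z‖ ^ (ν * (1 + 1 / α)) ≤
          B * (C ζ * (z - ζ) * (A z * F z - A ζ * F ζ + G ζ z)).re := by
  obtain ⟨c, hc, hAF⟩ := (hA.holderOn_closedBall hr.le hα1).mul_closedBall hr.le hα0.le hF
  set L : ℝ := c + M * (2 * r) ^ (1 - α) with hL
  have hL0 : 0 ≤ L := by positivity
  set R : ℝ := 2 * r * (L * (2 * r) ^ α) with hR
  refine ⟨max 1 ((L ^ (1 / α) * (R ^ (1 - 1 / ν) + K)) ^ ν), le_max_left _ _,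
    fun ζ hζ z hz => ?_⟩
  obtain ⟨hCn, hCw⟩ := hC ζ hζ
  have hmem := hCw z hz
  set H : ℂ := A z * F z - A ζ * F ζ + G ζ z with hH
  have hbound : ‖H‖ ≤ L * ‖z - ζ‖ ^ α := by
    calc ‖H‖ ≤ ‖A z * F z - A ζ * F ζ‖ + ‖G ζ z‖ := norm_add_le _ _
      _ ≤ c * ‖z - ζ‖ ^ α + M * ((2 * r) ^ (1 - α) * ‖z - ζ‖ ^ α) := by
          gcongr
          · exact hAF z hz ζ hζ.1
          · refine ((hG ζ hζ).2.2 z hz).trans ?_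
            gcongr
            exact norm_sub_le_mul_rpow hα1 hz hζ.1
      _ = L * ‖z - ζ‖ ^ α := by rw [hL]; ring
  have hdist : ‖z - ζ‖ ≤ 2 * r := by
    have := norm_sub_le z ζ
    have h1 := mem_closedBall_zero_iff.1 hz
    have h2 := mem_closedBall_zero_iff.1 hζ.1
    linarith
  have hnorm : ‖C ζ * (z - ζ) * H‖ = ‖z - ζ‖ * ‖H‖ := by
    rw [norm_mul, norm_mul, hCn, one_mul]
  have hnormR : ‖C ζ * (z - ζ) * H‖ ≤ R := by
    rw [hnorm, hR]
    gcongr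
    exact hbound.trans (by gcongr)
  refine (norm_rpow_le_of_mem_wedge hα0 hL0 hK.le hν (norm_nonneg _) hmem hnormR hnorm
    hbound).trans ?_
  exact mul_le_mul_of_nonneg_right (le_max_right _ _) hmem.1
end
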